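/- Let d ≥ 2 and assume a complete set of d+1 mutually unbiased bases exists in ℂ^d, with complete MUB ensemble M. Let G be a standard isotropic Gaussian Hamiltonian on ℂ^d, let R ≥ 0 be a real random variable independent of G with E[R] < ∞, and set H = R·G. Then for every labelled union S of d+1 orthonormal bases of ℂ^d (counting basis membership with multiplicity): E_H max_{ψ∈S} Tr(H Q_ψ) ≤ E_H max_{ψ∈M} Tr(H Q_ψ), and equivalently E_H min_{ψ∈M} Tr(H Q_ψ) ≤ E_H min_{ψ∈S} Tr(H Q_ψ). -/

import Mathlib

open MeasureTheory ProbabilityTheory Matrix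

noncomputable section

/-- The centered projection `Q_ψ = |ψ⟩⟨ψ| − I/d` associated to a vector `ψ ∈ ℂ^d`. -/
def Qmat {d : ℕ} (ψ : Fin d → ℂ) : Matrix (Fin d) (Fin d) ℂ :=
  Matrix.vecMulVec ψ (star ψ) - (d : ℂ)⁻¹ • (1 : Matrix (Fin d) (Fin d) ℂ)

/-- `B` is an orthonormal basis of `ℂ^d` (as a `d`-tuple of vectors). -/
def IsONB {d : ℕ} (B : Fin d → Fin d → ℂ) : Prop :=
  ∀ i j, star (B i) ⬝ᵥ B j = if i = j then (1 : ℂ) else 0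

/-- `B` is a complete system of `d+1` mutually unbiased bases of `ℂ^d`. -/
def IsCompleteMUB {d : ℕ} (B : Fin (d + 1) → Fin d → Fin d → ℂ) : Prop :=
  (∀ a, IsONB (B a)) ∧
    ∀ a b i j, a ≠ b → Complex.normSq (star (B a i) ⬝ᵥ B b j) = 1 / d

/-- `H` is a standard isotropic Gaussian Hamiltonian on `ℂ^d` under the probability
measure `μ`: it is `∑ k, g k • E k` for an orthonormal basis `E` of the real space of
traceless Hermitian `d×d` matrices (Hilbert–Schmidt inner product) and i.i.d. standard
real Gaussians `g k`. -/
def IsStdGaussianHamiltonian {d : ℕ} {Ω : Type*} [MeasurableSpace Ω]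
    (μ : Measure Ω) (H : Ω → Matrix (Fin d) (Fin d) ℂ) : Prop :=
  ∃ (E : Fin (d ^ 2 - 1) → Matrix (Fin d) (Fin d) ℂ)
    (g : Fin (d ^ 2 - 1) → Ω → ℝ),
      (∀ k, (E k).IsHermitian) ∧
      (∀ k, (E k).trace = 0) ∧
      (∀ k l, (E k * E l).trace = if k = l then (1 : ℂ) else 0) ∧
      Measurable (fun ω k => g k ω) ∧
      Measure.map (fun ω k => g k ω) μ =
        Measure.pi (fun _ : Fin (d ^ 2 - 1) => gaussianReal 0 1) ∧
      ∀ ω, H ω = ∑ k, (g k ω : ℂ) • E k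

/-- Matrices over `ℂ` carry the product measurable structure (entrywise). -/
instance matrixMeasurableSpace {d : ℕ} : MeasurableSpace (Matrix (Fin d) (Fin d) ℂ) :=
  MeasurableSpace.pi

section PrekopaLeindler

open scoped ENNReal

theorem volume_weighted_sum_le {a b : ℝ} (ha : 0 < a) (hb : 0 < b) {A B H : Set ℝ}
    (hA : MeasurableSet A) (hB : MeasurableSet B) (hA0 : A.Nonempty) (hB0 : B.Nonempty)
    (hH : ∀ x ∈ A, ∀ y ∈ B, a * x + b * y ∈ H) :
    ENNReal.ofReal a * volume A + ENNReal.ofReal b * volume B ≤ volume H := by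
  have key : ∀ K ⊆ A, ∀ K' ⊆ B, IsCompact K → IsCompact K' → K.Nonempty → K'.Nonempty →
      ENNReal.ofReal a * volume K + ENNReal.ofReal b * volume K' ≤ volume H := by
    intro K hK K' hK' hKc hKc' hK0 hK0'
    obtain ⟨p, hp, hpmax⟩ := hKc.exists_isGreatest hK0
    obtain ⟨q, hq, hqmin⟩ := hKc'.exists_isLeast hK0'
    have h1 : volume ((fun x => x + b * q) '' ((fun x => a * x) '' K)) =
        ENNReal.ofReal a * volume K := by
      rw [Set.image_add_right, measure_preimage_add_right]
      have := Measure.addHaar_smul (volume : Measure ℝ) a K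
      simp only [Module.finrank_self, pow_one, abs_of_pos ha] at this
      exact this
    have h2 : volume ((fun x => a * p + x) '' ((fun x => b * x) '' K')) =
        ENNReal.ofReal b * volume K' := by
      rw [Set.image_add_left, measure_preimage_add]
      have := Measure.addHaar_smul (volume : Measure ℝ) b K'
      simp only [Module.finrank_self, pow_one, abs_of_pos hb] at this
      exact this
    rw [← h1, ← h2, ← measure_union₀]
    · refine measure_mono ?_
      rintro _ (⟨_, ⟨x, hx, rfl⟩, rfl⟩ | ⟨_, ⟨x, hx, rfl⟩, rfl⟩)
      · exact hH _ (hK hx) _ (hK' hq)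
      · exact hH _ (hK hp) _ (hK' hx)
    · exact (((hKc'.image (by fun_prop)).image (by fun_prop)).measurableSet).nullMeasurableSet
    · refine measure_mono_null (t := {a * p + b * q}) ?_ (by simp)
      rintro z ⟨⟨_, ⟨x, hx, rfl⟩, rfl⟩, ⟨_, ⟨y, hy, rfl⟩, h⟩⟩
      have hx' := mul_le_mul_of_nonneg_left (hpmax hx) ha.le
      have hy' := mul_le_mul_of_nonneg_left (hqmin hy) hb.le
      simp only at h ⊢
      simp only [Set.mem_singleton_iff]
      linarith
  obtain ⟨x₀, hx₀⟩ := hA0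
  obtain ⟨y₀, hy₀⟩ := hB0
  have approx : ∀ (C : Set ℝ) (z : ℝ), MeasurableSet C → z ∈ C →
      volume C = ⨆ K : {K : Set ℝ // K ⊆ C ∧ IsCompact K ∧ K.Nonempty}, volume K.1 := by
    intro C z hC hz
    refine le_antisymm (le_of_forall_lt fun r hr => ?_) (iSup_le fun K => measure_mono K.2.1)
    obtain ⟨K, hKC, hKc, hr'⟩ := hC.exists_lt_isCompact hr
    refine hr'.trans_le ((measure_mono (Set.subset_insert z K)).trans ?_)
    exact le_iSup (fun K : {K : Set ℝ // K ⊆ C ∧ IsCompact K ∧ K.Nonempty} => volume K.1)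
      ⟨insert z K, Set.insert_subset hz hKC, hKc.insert z, Set.insert_nonempty _ _⟩
  rw [approx A x₀ hA hx₀, approx B y₀ hB hy₀, ENNReal.mul_iSup, ENNReal.mul_iSup]
  have : Nonempty {K : Set ℝ // K ⊆ A ∧ IsCompact K ∧ K.Nonempty} :=
    ⟨⟨{x₀}, by simpa using hx₀, isCompact_singleton, by simp⟩⟩
  have : Nonempty {K : Set ℝ // K ⊆ B ∧ IsCompact K ∧ K.Nonempty} :=
    ⟨⟨{y₀}, by simpa using hy₀, isCompact_singleton, by simp⟩⟩
  refine ENNReal.iSup_add_iSup_le fun K K' => ?_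
  exact key _ K.2.1 _ K'.2.1 K.2.2.1 K'.2.2.1 K.2.2.2 K'.2.2.2

theorem lintegral_eq_lintegral_meas_lt_ofReal {f : ℝ → ℝ≥0∞} (hf : Measurable f)
    (hf' : ∀ x, f x ≠ ∞) :
    ∫⁻ x, f x = ∫⁻ t in Set.Ioi (0 : ℝ), volume {x | ENNReal.ofReal t < f x} := by
  have := lintegral_eq_lintegral_meas_lt (f := fun x => (f x).toReal) volume
    (Filter.Eventually.of_forall fun x => ENNReal.toReal_nonneg) hf.ennreal_toReal.aemeasurable
  simp only [ENNReal.ofReal_toReal (hf' _)] at this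
  rw [this]
  refine setLIntegral_congr_fun measurableSet_Ioi fun t ht => ?_
  congr 1
  ext x
  exact (ENNReal.ofReal_lt_iff_lt_toReal (le_of_lt ht) (hf' x)).symm

theorem ENNReal.rpow_mul_rpow_le_add {a b : ℝ} (ha : 0 < a) (hb : 0 < b) (hab : a + b = 1)
    (x y : ℝ≥0∞) :
    x ^ a * y ^ b ≤ ENNReal.ofReal a * x + ENNReal.ofReal b * y := by
  have h := ENNReal.young_inequality (x ^ a) (y ^ b) (p := a⁻¹) (q := b⁻¹)
    ⟨by simpa using hab, by positivity, by positivity⟩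
  rw [← ENNReal.rpow_mul, ← ENNReal.rpow_mul, mul_inv_cancel₀ ha.ne', mul_inv_cancel₀ hb.ne',
    ENNReal.rpow_one, ENNReal.rpow_one, ENNReal.ofReal_inv_of_pos ha,
    ENNReal.ofReal_inv_of_pos hb, ENNReal.div_eq_inv_mul, ENNReal.div_eq_inv_mul, inv_inv,
    inv_inv] at h
  exact h

theorem prekopa_leindler_real_of_normalized {a b : ℝ} (ha : 0 < a) (hb : 0 < b)
    (hab : a + b = 1) {f g h : ℝ → ℝ≥0∞} (hf : Measurable f) (hg : Measurable g)
    (hh : Measurable h) (hf1 : ⨆ x, f x = 1) (hg1 : ⨆ x, g x = 1)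
    (H : ∀ x y, f x ^ a * g y ^ b ≤ h (a * x + b * y)) :
    (∫⁻ x, f x) ^ a * (∫⁻ x, g x) ^ b ≤ ∫⁻ x, h x := by
  have hfle : ∀ x, f x ≤ 1 := fun x => hf1 ▸ le_iSup f x
  have hgle : ∀ x, g x ≤ 1 := fun x => hg1 ▸ le_iSup g x
  refine (ENNReal.rpow_mul_rpow_le_add ha hb hab _ _).trans ?_
  have hmin : ∫⁻ x, min (h x) 1 ≤ ∫⁻ x, h x := lintegral_mono fun x => min_le_left _ _
  refine le_trans ?_ hmin
  rw [lintegral_eq_lintegral_meas_lt_ofReal hf fun x => ((hfle x).trans_lt ENNReal.one_lt_top).ne,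
    lintegral_eq_lintegral_meas_lt_ofReal hg fun x => ((hgle x).trans_lt ENNReal.one_lt_top).ne,
    lintegral_eq_lintegral_meas_lt_ofReal (f := fun x => min (h x) 1) (by fun_prop)
      fun x => ((min_le_right _ _).trans_lt ENNReal.one_lt_top).ne,
    ← lintegral_const_mul', ← lintegral_const_mul', ← lintegral_add_left]
  · refine setLIntegral_mono' measurableSet_Ioi fun t ht => ?_
    by_cases ht1 : ENNReal.ofReal t < 1
    · obtain ⟨x₀, hx₀⟩ := lt_iSup_iff.1 (hf1 ▸ ht1)
      obtain ⟨y₀, hy₀⟩ := lt_iSup_iff.1 (hg1 ▸ ht1)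
      refine volume_weighted_sum_le ha hb (measurableSet_lt measurable_const hf)
        (measurableSet_lt measurable_const hg) ⟨x₀, hx₀⟩ ⟨y₀, hy₀⟩ fun x hx y hy => ?_
      refine lt_min (lt_of_lt_of_le ?_ (H x y)) ht1
      have : ENNReal.ofReal t = ENNReal.ofReal t ^ a * ENNReal.ofReal t ^ b := by
        rw [← ENNReal.rpow_add _ _ (by simpa using ht) (by simp), hab, ENNReal.rpow_one]
      rw [this]
      exact ENNReal.mul_lt_mul (ENNReal.rpow_lt_rpow hx ha) (ENNReal.rpow_lt_rpow hy hb)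
    · have e1 : {x | ENNReal.ofReal t < f x} = ∅ := by
        ext x; simpa using (hfle x).trans (not_lt.1 ht1)
      have e2 : {x | ENNReal.ofReal t < g x} = ∅ := by
        ext x; simpa using (hgle x).trans (not_lt.1 ht1)
      simp [e1, e2]
  · refine Measurable.const_mul ?_ _
    refine Antitone.measurable fun s t hst => measure_mono fun x hx => ?_
    exact lt_of_le_of_lt (ENNReal.ofReal_le_ofReal hst) hx
  · simp
  · simp

theorem prekopa_leindler_real {a b : ℝ} (ha : 0 < a) (hb : 0 < b)
    (hab : a + b = 1) {f g h : ℝ → ℝ≥0∞} (hf : Measurable f) (hg : Measurable g)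
    (hh : Measurable h) (H : ∀ x y, f x ^ a * g y ^ b ≤ h (a * x + b * y)) :
    (∫⁻ x, f x) ^ a * (∫⁻ x, g x) ^ b ≤ ∫⁻ x, h x := by
  -- bounded functions reduce to functions with supremum one
  have bdd : ∀ f g : ℝ → ℝ≥0∞, Measurable f → Measurable g → (⨆ x, f x ≠ ∞) → (⨆ x, g x ≠ ∞) →
      (∀ x y, f x ^ a * g y ^ b ≤ h (a * x + b * y)) →
      (∫⁻ x, f x) ^ a * (∫⁻ x, g x) ^ b ≤ ∫⁻ x, h x := by
    intro f g hf hg hF hG H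
    set F := ⨆ x, f x with hFdef
    set G := ⨆ x, g x with hGdef
    by_cases hF0 : F = 0
    · have : ∀ x, f x = 0 := fun x => by
        have := le_iSup f x
        rw [← hFdef, hF0] at this
        simpa using this
      simp [this, ENNReal.zero_rpow_of_pos ha]
    by_cases hG0 : G = 0
    · have : ∀ x, g x = 0 := fun x => by
        have := le_iSup g x
        rw [← hGdef, hG0] at this
        simpa using this
      simp [this, ENNReal.zero_rpow_of_pos hb]
    set c := F ^ a * G ^ b with hc
    have hFa0 : F ^ a ≠ 0 := by simp [ENNReal.rpow_eq_zero_iff, hF0, hF]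
    have hGb0 : G ^ b ≠ 0 := by simp [ENNReal.rpow_eq_zero_iff, hG0, hG]
    have hFat : F ^ a ≠ ∞ := ENNReal.rpow_ne_top_of_nonneg ha.le hF
    have hGbt : G ^ b ≠ ∞ := ENNReal.rpow_ne_top_of_nonneg hb.le hG
    have hc0 : c ≠ 0 := mul_ne_zero hFa0 hGb0
    have hct : c ≠ ∞ := ENNReal.mul_ne_top hFat hGbt
    have hcinv : c⁻¹ = F⁻¹ ^ a * G⁻¹ ^ b := by
      rw [hc, ENNReal.mul_inv (Or.inl hFa0) (Or.inl hFat), ENNReal.inv_rpow, ENNReal.inv_rpow]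
    have main := prekopa_leindler_real_of_normalized ha hb hab
      (f := fun x => F⁻¹ * f x) (g := fun x => G⁻¹ * g x) (h := fun x => c⁻¹ * h x)
      (by fun_prop) (by fun_prop) (by fun_prop)
      (by rw [← ENNReal.mul_iSup]; exact ENNReal.inv_mul_cancel hF0 hF)
      (by rw [← ENNReal.mul_iSup]; exact ENNReal.inv_mul_cancel hG0 hG)
      (by
        intro x y
        rw [ENNReal.mul_rpow_of_nonneg _ _ ha.le, ENNReal.mul_rpow_of_nonneg _ _ hb.le,
          mul_mul_mul_comm, ← hcinv]
        gcongr
        exact H x y)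
    rw [lintegral_const_mul _ hf, lintegral_const_mul _ hg, lintegral_const_mul _ hh,
      ENNReal.mul_rpow_of_nonneg _ _ ha.le, ENNReal.mul_rpow_of_nonneg _ _ hb.le,
      mul_mul_mul_comm, ← hcinv] at main
    exact (ENNReal.mul_le_mul_iff_right (by simpa using hct) (by simpa using hc0)).1 main
  have lim : ∀ f : ℝ → ℝ≥0∞, Measurable f →
      Filter.Tendsto (fun k : ℕ => ∫⁻ x, min (f x) k) Filter.atTop (nhds (∫⁻ x, f x)) := by
    intro f hf
    refine lintegral_tendsto_of_tendsto_of_monotone (fun k => by fun_prop)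
      (Filter.Eventually.of_forall fun x k l hkl => by dsimp; gcongr)
      (Filter.Eventually.of_forall fun x => ?_)
    have := (tendsto_const_nhds (x := f x)).min ENNReal.tendsto_nat_nhds_top
    simpa using this
  have hk : ∀ k : ℕ, (∫⁻ x, min (f x) k) ^ a * (∫⁻ x, min (g x) k) ^ b ≤ ∫⁻ x, h x := by
    intro k
    refine bdd _ _ (by fun_prop) (by fun_prop) ?_ ?_ fun x y => le_trans ?_ (H x y)
    · exact ((iSup_le fun x => min_le_right _ _).trans_lt (ENNReal.natCast_lt_top k)).ne
    · exact ((iSup_le fun x => min_le_right _ _).trans_lt (ENNReal.natCast_lt_top k)).ne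
    · gcongr <;> exact min_le_left _ _
  by_cases hf0 : ∫⁻ x, f x = 0
  · simp [hf0, ENNReal.zero_rpow_of_pos ha]
  by_cases hg0 : ∫⁻ x, g x = 0
  · simp [hg0, ENNReal.zero_rpow_of_pos hb]
  refine le_of_tendsto' (ENNReal.Tendsto.mul ((lim f hf).ennrpow_const a) ?_
    ((lim g hg).ennrpow_const b) ?_) hk
  · left; simp [ENNReal.rpow_eq_zero_iff, hf0, ha.not_gt]
  · left; simp [ENNReal.rpow_eq_zero_iff, hg0, hb.not_gt]

theorem gaussianPDF_rpow_mul_rpow_le {a b : ℝ} (ha : 0 < a) (hb : 0 < b) (hab : a + b = 1)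
    (x y : ℝ) :
    gaussianPDF 0 1 x ^ a * gaussianPDF 0 1 y ^ b ≤ gaussianPDF 0 1 (a * x + b * y) := by
  rw [gaussianPDF, gaussianPDF, gaussianPDF,
    ENNReal.ofReal_rpow_of_nonneg (gaussianPDFReal_nonneg _ _ _) ha.le,
    ENNReal.ofReal_rpow_of_nonneg (gaussianPDFReal_nonneg _ _ _) hb.le,
    ← ENNReal.ofReal_mul (Real.rpow_nonneg (gaussianPDFReal_nonneg _ _ _) _)]
  refine ENNReal.ofReal_le_ofReal ?_
  simp only [gaussianPDFReal]
  rw [Real.mul_rpow (by positivity) (by positivity), Real.mul_rpow (by positivity) (by positivity),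
    mul_mul_mul_comm, ← Real.rpow_add (by positivity), hab, Real.rpow_one, ← Real.exp_mul,
    ← Real.exp_mul, ← Real.exp_add]
  gcongr
  simp only [sub_zero, NNReal.coe_one, mul_one]
  obtain rfl : b = 1 - a := by linarith
  nlinarith [mul_nonneg (mul_nonneg ha.le hb.le) (sq_nonneg (x - y))]

theorem prekopa_leindler_gaussianReal {a b : ℝ} (ha : 0 < a) (hb : 0 < b)
    (hab : a + b = 1) {f g h : ℝ → ℝ≥0∞} (hf : Measurable f) (hg : Measurable g)
    (hh : Measurable h) (H : ∀ x y, f x ^ a * g y ^ b ≤ h (a * x + b * y)) :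
    (∫⁻ x, f x ∂gaussianReal 0 1) ^ a * (∫⁻ x, g x ∂gaussianReal 0 1) ^ b ≤
      ∫⁻ x, h x ∂gaussianReal 0 1 := by
  have hp := measurable_gaussianPDF 0 1
  rw [gaussianReal_of_var_ne_zero _ one_ne_zero, lintegral_withDensity_eq_lintegral_mul _ hp hf,
    lintegral_withDensity_eq_lintegral_mul _ hp hg, lintegral_withDensity_eq_lintegral_mul _ hp hh]
  refine prekopa_leindler_real ha hb hab (hp.mul hf) (hp.mul hg) (hp.mul hh) fun x y => ?_
  simp only [Pi.mul_apply]
  rw [ENNReal.mul_rpow_of_nonneg _ _ ha.le, ENNReal.mul_rpow_of_nonneg _ _ hb.le,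
    mul_mul_mul_comm]
  exact mul_le_mul' (gaussianPDF_rpow_mul_rpow_le ha hb hab x y) (H x y)

/-- The standard Gaussian measure on `ι → ℝ`. -/
def piGaussian (ι : Type*) [Fintype ι] : Measure (ι → ℝ) :=
  Measure.pi fun _ => gaussianReal 0 1

instance isProbabilityMeasure_piGaussian (ι : Type*) [Fintype ι] :
    IsProbabilityMeasure (piGaussian ι) := by
  unfold piGaussian
  infer_instance

theorem prekopa_leindler {a b : ℝ} (ha : 0 < a) (hb : 0 < b) (hab : a + b = 1) {n : ℕ}
    {f g h : (Fin n → ℝ) → ℝ≥0∞} (hf : Measurable f) (hg : Measurable g) (hh : Measurable h)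
    (H : ∀ x y, f x ^ a * g y ^ b ≤ h (a • x + b • y)) :
    (∫⁻ x, f x ∂piGaussian _) ^ a * (∫⁻ x, g x ∂piGaussian _) ^ b ≤
      ∫⁻ x, h x ∂piGaussian _ := by
  unfold piGaussian
  induction n with
  | zero =>
    have e : ∀ f : (Fin 0 → ℝ) → ℝ≥0∞, ∫⁻ x, f x ∂Measure.pi (fun _ => gaussianReal 0 1) = f 0 := by
      intro f
      rw [Measure.pi_of_empty _ 0, lintegral_dirac]
    rw [e, e, e]
    simpa using H 0 0
  | succ n ih =>
    have e : ∀ f : (Fin (n + 1) → ℝ) → ℝ≥0∞, Measurable f →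
        ∫⁻ x, f x ∂Measure.pi (fun _ => gaussianReal 0 1) =
          ∫⁻ s, ∫⁻ y : Fin n → ℝ, f (Fin.insertNth (α := fun _ => ℝ) 0 s y)
            ∂Measure.pi (fun _ => gaussianReal 0 1) ∂gaussianReal 0 1 := by
      intro f hf
      have := (measurePreserving_piFinSuccAbove (fun _ : Fin (n + 1) => gaussianReal 0 1) 0).symm
      rw [← this.lintegral_comp hf, lintegral_prod]
      · rfl
      · exact (hf.comp this.measurable).aemeasurable
    have m : ∀ f : (Fin (n + 1) → ℝ) → ℝ≥0∞, Measurable f →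
        Measurable fun p : ℝ × (Fin n → ℝ) => f (Fin.insertNth (α := fun _ => ℝ) 0 p.1 p.2) := by
      intro f hf
      exact hf.comp
        (measurePreserving_piFinSuccAbove
          (fun _ : Fin (n + 1) => gaussianReal 0 1) 0).symm.measurable
    rw [e f hf, e g hg, e h hh]
    refine prekopa_leindler_gaussianReal ha hb hab (m f hf).lintegral_prod_right'
      (m g hg).lintegral_prod_right' (m h hh).lintegral_prod_right' fun s t => ?_
    refine ih ((m f hf).comp (by fun_prop : Measurable fun y : Fin n → ℝ => (s, y)))
      ((m g hg).comp (by fun_prop : Measurable fun y : Fin n → ℝ => (t, y)))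
      ((m h hh).comp (by fun_prop : Measurable fun y : Fin n → ℝ => (a * s + b * t, y)))
      fun x y => ?_
    refine (H _ _).trans (le_of_eq ?_)
    congr 1
    ext i
    refine Fin.cases ?_ (fun j => ?_) i <;> simp

end PrekopaLeindler

section GaussianBasics

theorem measurePreserving_eval_piGaussian {ι : Type*} [Fintype ι] (i : ι) :
    MeasurePreserving (fun x : ι → ℝ => x i) (piGaussian ι) (gaussianReal 0 1) :=
  measurePreserving_eval (fun _ => gaussianReal 0 1) i

instance isGaussian_piGaussian (ι : Type*) [Fintype ι] : IsGaussian (piGaussian ι) := by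
  have h1 : iIndepFun (fun (i : ι) (x : ι → ℝ) => x i) (piGaussian ι) :=
    iIndepFun_pi (X := fun _ x => x) fun _ => aemeasurable_id
  have h2 : ∀ i : ι, HasGaussianLaw (fun x : ι → ℝ => x i) (piGaussian ι) := fun i =>
    ⟨by rw [(measurePreserving_eval_piGaussian i).map_eq]; infer_instance⟩
  have := (h1.hasGaussianLaw h2).isGaussian_map
  simpa using this

theorem integrable_eval_piGaussian {ι : Type*} [Fintype ι] (i : ι) :
    Integrable (fun x : ι → ℝ => x i) (piGaussian ι) :=
  IsGaussian.integrable_dual (piGaussian ι) (ContinuousLinearMap.proj (R := ℝ) i)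

theorem integral_eval_piGaussian {ι : Type*} [Fintype ι] (i : ι) :
    ∫ x : ι → ℝ, x i ∂piGaussian ι = 0 := by
  have h := integral_map (μ := piGaussian ι) (φ := fun x : ι → ℝ => x i) (f := fun y => y)
    (measurable_pi_apply i).aemeasurable (by fun_prop)
  rw [← h, (measurePreserving_eval_piGaussian i).map_eq, integral_id_gaussianReal]

theorem strongDual_apply_eq_sum {ι : Type*} [Fintype ι] [DecidableEq ι]
    (L : StrongDual ℝ (ι → ℝ)) (x : ι → ℝ) :
    L x = ∑ i, x i * L (Pi.single i 1) := by
  conv_lhs => rw [pi_eq_sum_univ x, map_sum]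
  refine Finset.sum_congr rfl fun i _ => ?_
  rw [map_smul, smul_eq_mul]
  congr 2
  ext j
  rw [Pi.single_apply]
  exact if_congr eq_comm rfl rfl

theorem integral_strongDual_piGaussian {ι : Type*} [Fintype ι] (L : StrongDual ℝ (ι → ℝ)) :
    (piGaussian ι)[L] = 0 := by
  classical
  rw [integral_congr_ae (Filter.Eventually.of_forall (strongDual_apply_eq_sum L)),
    integral_finsetSum _ fun i _ => (integrable_eval_piGaussian i).mul_const _]
  exact Finset.sum_eq_zero fun i _ => by
    rw [integral_mul_const, integral_eval_piGaussian, zero_mul]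

/-- The number `1 / √2`. -/
def invSqrtTwo : ℝ := √2 / 2

theorem invSqrtTwo_mul_self : invSqrtTwo * invSqrtTwo = 1 / 2 := by
  unfold invSqrtTwo
  nlinarith [Real.mul_self_sqrt (show (0:ℝ) ≤ 2 by norm_num)]

theorem integral_prod_rotate {X F : Type*} [NormedAddCommGroup X] [NormedSpace ℝ X]
    [MeasurableSpace X] [BorelSpace X] [SecondCountableTopology X] [CompleteSpace X]
    [NormedAddCommGroup F] [NormedSpace ℝ F]
    (μ : Measure X) [IsGaussian μ] (hμ : ∀ L : StrongDual ℝ X, μ[L] = 0) {f : X × X → F}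
    (hf : AEStronglyMeasurable f (μ.prod μ)) :
    ∫ z, f (invSqrtTwo • (z.1 - z.2), invSqrtTwo • (z.1 + z.2)) ∂μ.prod μ =
      ∫ z, f z ∂μ.prod μ := by
  have h := IsGaussian.map_rotation_eq_self_of_forall_strongDual_eq_zero hμ (-(Real.pi / 4))
  conv_rhs => rw [← h]
  rw [integral_map (by fun_prop) (by rwa [h])]
  congr with z
  congr 1
  rw [ContinuousLinearMap.rotation_apply]
  simp only [Real.cos_neg, Real.sin_neg, Real.cos_pi_div_four, Real.sin_pi_div_four, invSqrtTwo]
  ext1 <;> module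

theorem integrable_prod_rotate {X F : Type*} [NormedAddCommGroup X] [NormedSpace ℝ X]
    [MeasurableSpace X] [BorelSpace X] [SecondCountableTopology X] [CompleteSpace X]
    [NormedAddCommGroup F] [NormedSpace ℝ F]
    (μ : Measure X) [IsGaussian μ] (hμ : ∀ L : StrongDual ℝ X, μ[L] = 0) {f : X × X → F}
    (hf : Integrable f (μ.prod μ)) :
    Integrable (fun z => f (invSqrtTwo • (z.1 - z.2), invSqrtTwo • (z.1 + z.2))) (μ.prod μ) := by
  have h := IsGaussian.map_rotation_eq_self_of_forall_strongDual_eq_zero hμ (-(Real.pi / 4))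
  rw [← h] at hf
  convert hf.comp_aemeasurable (by fun_prop) using 1
  ext z
  simp only [Function.comp]
  congr 1
  rw [ContinuousLinearMap.rotation_apply]
  simp only [Real.cos_neg, Real.sin_neg, Real.cos_pi_div_four, Real.sin_pi_div_four, invSqrtTwo]
  ext1 <;> module

end GaussianBasics

section LogIntegral

open scoped ENNReal

theorem lintegral_ofReal_exp {X : Type*} [MeasurableSpace X] {μ : Measure X} {U : X → ℝ}
    (hU : Integrable (fun x => Real.exp (U x)) μ) :
    ∫⁻ x, ENNReal.ofReal (Real.exp (U x)) ∂μ = ENNReal.ofReal (∫ x, Real.exp (U x) ∂μ) :=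
  (ofReal_integral_eq_lintegral_ofReal hU
    (Filter.Eventually.of_forall fun _ => (Real.exp_pos _).le)).symm

theorem ofReal_rpow_mul_ofReal_rpow_le {a b p q r : ℝ} (hp : 0 < p) (hq : 0 < q) (hr : 0 < r) :
    ENNReal.ofReal p ^ a * ENNReal.ofReal q ^ b ≤ ENNReal.ofReal r ↔
      a * Real.log p + b * Real.log q ≤ Real.log r := by
  rw [ENNReal.ofReal_rpow_of_pos hp, ENNReal.ofReal_rpow_of_pos hq,
    ← ENNReal.ofReal_mul (by positivity), ENNReal.ofReal_le_ofReal_iff hr.le,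
    Real.le_log_iff_exp_le hr, Real.exp_add, Real.rpow_def_of_pos hp, Real.rpow_def_of_pos hq,
    mul_comm a, mul_comm b]

theorem le_ofReal_rpow_mul_ofReal_rpow {a b p q r : ℝ} (hp : 0 < p) (hq : 0 < q) (hr : 0 < r) :
    ENNReal.ofReal r ≤ ENNReal.ofReal p ^ a * ENNReal.ofReal q ^ b ↔
      Real.log r ≤ a * Real.log p + b * Real.log q := by
  rw [ENNReal.ofReal_rpow_of_pos hp, ENNReal.ofReal_rpow_of_pos hq,
    ← ENNReal.ofReal_mul (by positivity), ENNReal.ofReal_le_ofReal_iff (by positivity),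
    Real.log_le_iff_le_exp hr, Real.exp_add, Real.rpow_def_of_pos hp, Real.rpow_def_of_pos hq,
    mul_comm a, mul_comm b]

theorem log_integral_exp_ge {a b : ℝ} (ha : 0 < a) (hb : 0 < b) (hab : a + b = 1) {n : ℕ}
    {U₁ U₂ U₃ : (Fin n → ℝ) → ℝ} (h1 : Measurable U₁) (h2 : Measurable U₂) (h3 : Measurable U₃)
    (i1 : Integrable (fun x => Real.exp (U₁ x)) (piGaussian _))
    (i2 : Integrable (fun x => Real.exp (U₂ x)) (piGaussian _))
    (i3 : Integrable (fun x => Real.exp (U₃ x)) (piGaussian _))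
    (H : ∀ x y, a * U₁ x + b * U₂ y ≤ U₃ (a • x + b • y)) :
    a * Real.log (∫ x, Real.exp (U₁ x) ∂piGaussian _) +
      b * Real.log (∫ x, Real.exp (U₂ x) ∂piGaussian _) ≤
      Real.log (∫ x, Real.exp (U₃ x) ∂piGaussian _) := by
  rw [← ofReal_rpow_mul_ofReal_rpow_le (integral_exp_pos i1) (integral_exp_pos i2)
    (integral_exp_pos i3), ← lintegral_ofReal_exp i1, ← lintegral_ofReal_exp i2,
    ← lintegral_ofReal_exp i3]
  refine prekopa_leindler ha hb hab (by fun_prop) (by fun_prop) (by fun_prop) fun x y => ?_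
  rw [ofReal_rpow_mul_ofReal_rpow_le (Real.exp_pos _) (Real.exp_pos _) (Real.exp_pos _)]
  simpa using H x y

theorem log_integral_exp_le {a b : ℝ} (ha : 0 < a) (hb : 0 < b) (hab : a + b = 1)
    {X : Type*} [MeasurableSpace X] {μ : Measure X} [NeZero μ]
    {U₁ U₂ U₃ : X → ℝ} (h1 : Measurable U₁) (h2 : Measurable U₂)
    (i1 : Integrable (fun x => Real.exp (U₁ x)) μ)
    (i2 : Integrable (fun x => Real.exp (U₂ x)) μ)
    (i3 : Integrable (fun x => Real.exp (U₃ x)) μ)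
    (H : ∀ x, U₃ x ≤ a * U₁ x + b * U₂ x) :
    Real.log (∫ x, Real.exp (U₃ x) ∂μ) ≤ a * Real.log (∫ x, Real.exp (U₁ x) ∂μ) +
      b * Real.log (∫ x, Real.exp (U₂ x) ∂μ) := by
  rw [← le_ofReal_rpow_mul_ofReal_rpow (integral_exp_pos i1) (integral_exp_pos i2)
    (integral_exp_pos i3), ← lintegral_ofReal_exp i1, ← lintegral_ofReal_exp i2,
    ← lintegral_ofReal_exp i3]
  refine (lintegral_mono fun x => ?_).trans
    (ENNReal.lintegral_mul_norm_pow_le (by fun_prop) (by fun_prop) ha.le hb.le hab)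
  rw [le_ofReal_rpow_mul_ofReal_rpow (Real.exp_pos _) (Real.exp_pos _) (Real.exp_pos _)]
  simpa using H x

end LogIntegral

section Potentials

variable {n : ℕ}

/-- The squared Euclidean norm. -/
def normSqPi (x : Fin n → ℝ) : ℝ := ∑ i, x i ^ 2

theorem normSqPi_nonneg (x : Fin n → ℝ) : 0 ≤ normSqPi x :=
  Finset.sum_nonneg fun _ _ => sq_nonneg _

@[fun_prop]
theorem continuous_normSqPi : Continuous (normSqPi : (Fin n → ℝ) → ℝ) := by
  unfold normSqPi
  fun_prop

theorem normSqPi_rotate (x y : Fin n → ℝ) :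
    normSqPi (invSqrtTwo • (x - y)) + normSqPi (invSqrtTwo • (x + y)) =
      normSqPi x + normSqPi y := by
  simp only [normSqPi, ← Finset.sum_add_distrib]
  refine Finset.sum_congr rfl fun i _ => ?_
  simp only [Pi.smul_apply, Pi.sub_apply, Pi.add_apply, smul_eq_mul]
  linear_combination (2 * (x i) ^ 2 + 2 * (y i) ^ 2) * invSqrtTwo_mul_self

/-- Potentials of log-concave functions whose Hessian is at most `lam`. -/
structure IsPotential (lam : ℝ) (V : (Fin n → ℝ) → ℝ) : Prop where
  convex : ConvexOn ℝ Set.univ V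
  smooth : ConvexOn ℝ Set.univ fun x => lam / 2 * normSqPi x - V x
  bdd : ∃ K, ∀ x, K ≤ V x

/-- The sections of the rotated function `V ⊕ V`. -/
def rotSection (V : (Fin n → ℝ) → ℝ) (x y : Fin n → ℝ) : ℝ :=
  V (invSqrtTwo • (x - y)) + V (invSqrtTwo • (x + y))

/-- The potential of the marginal of the rotated function `V ⊕ V`. -/
def rotMarginal (V : (Fin n → ℝ) → ℝ) (x : Fin n → ℝ) : ℝ :=
  -Real.log (∫ y, Real.exp (-rotSection V x y) ∂piGaussian _)

namespace IsPotential

variable {lam : ℝ} {V : (Fin n → ℝ) → ℝ}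

theorem continuous (hV : IsPotential lam V) : Continuous V :=
  hV.convex.locallyLipschitz.continuous

theorem continuous_rotSection (hV : IsPotential lam V) :
    Continuous fun p : (Fin n → ℝ) × (Fin n → ℝ) => rotSection V p.1 p.2 := by
  have := hV.continuous
  unfold rotSection
  fun_prop

theorem add_const (hV : IsPotential lam V) (k : ℝ) : IsPotential lam fun x => V x + k := by
  refine ⟨hV.convex.add_const k, ?_, ?_⟩
  · have := hV.smooth.add_const (-k)
    refine this.congr fun x _ => ?_
    simp only [Pi.add_apply]
    ring
  · obtain ⟨K, hK⟩ := hV.bdd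
    exact ⟨K + k, fun x => by linarith [hK x]⟩

theorem integrable_exp {X : Type*} [MeasurableSpace X] {μ : Measure X} [IsFiniteMeasure μ]
    {U : X → ℝ} (hU : Measurable U) {K : ℝ} (hK : ∀ x, U x ≤ K) :
    Integrable (fun x => Real.exp (U x)) μ :=
  Integrable.of_bound (by fun_prop) (Real.exp K) (Filter.Eventually.of_forall fun x => by
    rw [Real.norm_eq_abs, Real.abs_exp]
    exact Real.exp_le_exp.2 (hK x))

theorem integrable (hV : IsPotential lam V) (μ : Measure (Fin n → ℝ)) [IsFiniteMeasure μ] :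
    Integrable (fun x => Real.exp (-V x)) μ := by
  obtain ⟨K, hK⟩ := hV.bdd
  exact integrable_exp hV.continuous.measurable.neg (K := -K) fun x => neg_le_neg (hK x)

theorem integral_pos (hV : IsPotential lam V) :
    0 < ∫ x, Real.exp (-V x) ∂piGaussian _ :=
  integral_exp_pos (hV.integrable _)

theorem convex_iff {U : (Fin n → ℝ) → ℝ} : ConvexOn ℝ Set.univ U ↔
    ∀ x y (a b : ℝ), 0 < a → 0 < b → a + b = 1 → U (a • x + b • y) ≤ a * U x + b * U y := by
  rw [convexOn_iff_forall_pos]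
  simp [convex_univ]

theorem rotSection (hV : IsPotential lam V) (x : Fin n → ℝ) :
    IsPotential lam (rotSection V x) := by
  have key : ∀ U : (Fin n → ℝ) → ℝ, ConvexOn ℝ Set.univ U →
      ConvexOn ℝ Set.univ (fun y => U (invSqrtTwo • (x - y)) + U (invSqrtTwo • (x + y))) := by
    intro U hU
    rw [convex_iff] at hU ⊢
    intro y z a b ha hb hab
    have h1 := hU (invSqrtTwo • (x - y)) (invSqrtTwo • (x - z)) a b ha hb hab
    have h2 := hU (invSqrtTwo • (x + y)) (invSqrtTwo • (x + z)) a b ha hb hab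
    have e1 : a • invSqrtTwo • (x - y) + b • invSqrtTwo • (x - z) =
        invSqrtTwo • (x - (a • y + b • z)) := by
      obtain rfl : b = 1 - a := by linarith
      module
    have e2 : a • invSqrtTwo • (x + y) + b • invSqrtTwo • (x + z) =
        invSqrtTwo • (x + (a • y + b • z)) := by
      obtain rfl : b = 1 - a := by linarith
      module
    rw [e1] at h1
    rw [e2] at h2
    linarith
  refine ⟨key V hV.convex, ?_, ?_⟩
  · refine ((key _ hV.smooth).add_const (-(lam / 2 * normSqPi x))).congr fun y _ => ?_
    simp only [Pi.add_apply, _root_.rotSection]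
    linear_combination (lam / 2) * normSqPi_rotate x y
  · obtain ⟨K, hK⟩ := hV.bdd
    exact ⟨K + K, fun y => add_le_add (hK _) (hK _)⟩

theorem exp_neg_rotMarginal (hV : IsPotential lam V) (x : Fin n → ℝ) :
    Real.exp (-rotMarginal V x) = ∫ y, Real.exp (-_root_.rotSection V x y) ∂piGaussian _ := by
  rw [rotMarginal, neg_neg, Real.exp_log (hV.rotSection x).integral_pos]

theorem rotMarginal (hV : IsPotential lam V) : IsPotential lam (rotMarginal V) := by
  have hc := hV.continuous
  obtain ⟨K, hK⟩ := hV.bdd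
  refine ⟨?_, ?_, ?_⟩
  · rw [convex_iff]
    intro x y a b ha hb hab
    have := log_integral_exp_ge ha hb hab (n := n)
      (hV.rotSection x).continuous.measurable.neg (hV.rotSection y).continuous.measurable.neg
      (hV.rotSection (a • x + b • y)).continuous.measurable.neg
      ((hV.rotSection x).integrable _) ((hV.rotSection y).integrable _)
      ((hV.rotSection (a • x + b • y)).integrable _) fun u v => ?_
    · simp only [_root_.rotMarginal, Pi.neg_apply] at this ⊢
      linarith
    · simp only [Pi.neg_apply, _root_.rotSection]
      have h1 := convex_iff.1 hV.convex (invSqrtTwo • (x - u)) (invSqrtTwo • (y - v)) a b ha hb hab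
      have h2 := convex_iff.1 hV.convex (invSqrtTwo • (x + u)) (invSqrtTwo • (y + v)) a b ha hb hab
      have e1 : a • invSqrtTwo • (x - u) + b • invSqrtTwo • (y - v) =
          invSqrtTwo • (a • x + b • y - (a • u + b • v)) := by module
      have e2 : a • invSqrtTwo • (x + u) + b • invSqrtTwo • (y + v) =
          invSqrtTwo • (a • x + b • y + (a • u + b • v)) := by module
      rw [e1] at h1
      rw [e2] at h2
      linarith
  · have key : ∀ x, lam / 2 * normSqPi x - _root_.rotMarginal V x =
        Real.log (∫ y, Real.exp (lam / 2 * normSqPi x - _root_.rotSection V x y)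
          ∂piGaussian _) := by
      intro x
      simp_rw [sub_eq_add_neg (lam / 2 * normSqPi x), Real.exp_add, integral_const_mul]
      rw [Real.log_mul (Real.exp_pos _).ne' (hV.rotSection x).integral_pos.ne', Real.log_exp,
        _root_.rotMarginal, neg_neg]
    have hi : ∀ x, Integrable (fun y => Real.exp (lam / 2 * normSqPi x - _root_.rotSection V x y))
        (piGaussian (Fin n)) := fun x => by
      simp_rw [sub_eq_add_neg (lam / 2 * normSqPi x), Real.exp_add]
      exact ((hV.rotSection x).integrable _).const_mul _
    simp_rw [key]
    rw [convex_iff]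
    intro x y a b ha hb hab
    refine log_integral_exp_le ha hb hab
      (measurable_const.sub (hV.rotSection x).continuous.measurable)
      (measurable_const.sub (hV.rotSection y).continuous.measurable) (hi _) (hi _) (hi _)
      fun u => ?_
    have h1 := convex_iff.1 hV.smooth (invSqrtTwo • (x - u)) (invSqrtTwo • (y - u)) a b ha hb hab
    have h2 := convex_iff.1 hV.smooth (invSqrtTwo • (x + u)) (invSqrtTwo • (y + u)) a b ha hb hab
    have e1 : a • invSqrtTwo • (x - u) + b • invSqrtTwo • (y - u) =
        invSqrtTwo • (a • x + b • y - u) := by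
      obtain rfl : b = 1 - a := by linarith
      module
    have e2 : a • invSqrtTwo • (x + u) + b • invSqrtTwo • (y + u) =
        invSqrtTwo • (a • x + b • y + u) := by
      obtain rfl : b = 1 - a := by linarith
      module
    rw [e1] at h1
    rw [e2] at h2
    simp only [_root_.rotSection]
    have n1 := normSqPi_rotate x u
    have n2 := normSqPi_rotate y u
    have n3 := normSqPi_rotate (a • x + b • y) u
    obtain rfl : b = 1 - a := by linarith
    linear_combination h1 + h2 - lam / 2 * n3 + a * (lam / 2) * n1 + (1 - a) * (lam / 2) * n2
  · refine ⟨K + K, fun x => ?_⟩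
    have h : ∫ y, Real.exp (-_root_.rotSection V x y) ∂piGaussian (Fin n) ≤ Real.exp (-(K + K)) := by
      calc _ ≤ ∫ y, Real.exp (-(K + K)) ∂piGaussian (Fin n) :=
            integral_mono ((hV.rotSection x).integrable _) (integrable_const _) fun y =>
              Real.exp_le_exp.2 (neg_le_neg (add_le_add (hK _) (hK _)))
        _ = _ := by simp
    rw [← Real.log_le_iff_le_exp (hV.rotSection x).integral_pos] at h
    rw [_root_.rotMarginal]
    linarith

end IsPotential

end Potentials

section RotMarginal

variable {n : ℕ}

/-- The Gaussian integral of `exp (-V)`. -/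
def gaussMass (V : (Fin n → ℝ) → ℝ) : ℝ := ∫ x, Real.exp (-V x) ∂piGaussian _

theorem exp_neg_rotSection (V : (Fin n → ℝ) → ℝ) (x y : Fin n → ℝ) :
    Real.exp (-rotSection V x y) =
      Real.exp (-V (invSqrtTwo • (x - y))) * Real.exp (-V (invSqrtTwo • (x + y))) := by
  rw [rotSection, neg_add, Real.exp_add]

theorem rotSection_neg_right (V : (Fin n → ℝ) → ℝ) (x y : Fin n → ℝ) :
    rotSection V x (-y) = rotSection V x y := by
  simp [rotSection, add_comm, sub_eq_add_neg]

theorem rotSection_neg_left {V : (Fin n → ℝ) → ℝ} (hV : ∀ x, V (-x) = V x) (x y : Fin n → ℝ) :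
    rotSection V (-x) y = rotSection V x y := by
  have e1 : invSqrtTwo • (-x - y) = -(invSqrtTwo • (x + y)) := by module
  have e2 : invSqrtTwo • (-x + y) = -(invSqrtTwo • (x - y)) := by module
  rw [rotSection, rotSection, e1, e2, hV, hV, add_comm]

theorem rotMarginal_neg {V : (Fin n → ℝ) → ℝ} (hV : ∀ x, V (-x) = V x) (x : Fin n → ℝ) :
    rotMarginal V (-x) = rotMarginal V x := by
  simp_rw [rotMarginal, rotSection_neg_left hV]

theorem gaussMass_add_const (V : (Fin n → ℝ) → ℝ) (k : ℝ) :
    gaussMass (fun x => V x + k) = Real.exp (-k) * gaussMass V := by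
  simp_rw [gaussMass, neg_add_rev, Real.exp_add, integral_const_mul]

namespace IsPotential

variable {lam : ℝ} {V : (Fin n → ℝ) → ℝ}

theorem gaussMass_pos (hV : IsPotential lam V) : 0 < gaussMass V := hV.integral_pos

theorem integrable_prod (hV : IsPotential lam V) :
    Integrable (fun z : (Fin n → ℝ) × (Fin n → ℝ) => Real.exp (-V z.1) * Real.exp (-V z.2))
      ((piGaussian _).prod (piGaussian _)) :=
  (hV.integrable _).mul_prod (hV.integrable _)

theorem integrable_rotSection (hV : IsPotential lam V) :
    Integrable (fun z : (Fin n → ℝ) × (Fin n → ℝ) => Real.exp (-_root_.rotSection V z.1 z.2))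
      ((piGaussian _).prod (piGaussian _)) := by
  simp_rw [exp_neg_rotSection]
  exact integrable_prod_rotate _ integral_strongDual_piGaussian hV.integrable_prod

theorem gaussMass_rotMarginal (hV : IsPotential lam V) :
    gaussMass (_root_.rotMarginal V) = gaussMass V ^ 2 := by
  simp_rw [gaussMass, hV.exp_neg_rotMarginal]
  rw [integral_integral hV.integrable_rotSection, sq, ← integral_prod_mul]
  simp_rw [exp_neg_rotSection]
  exact integral_prod_rotate _ integral_strongDual_piGaussian
    hV.integrable_prod.aestronglyMeasurable

theorem integrable_eval_mul (hV : IsPotential lam V) (i : Fin n) :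
    Integrable (fun x => x i * Real.exp (-V x)) (piGaussian _) := by
  obtain ⟨K, hK⟩ := hV.bdd
  have := hV.continuous
  refine (integrable_eval_piGaussian i).mul_bdd (c := Real.exp (-K)) (by fun_prop)
    (Filter.Eventually.of_forall fun x => ?_)
  rw [Real.norm_eq_abs, Real.abs_exp]
  exact Real.exp_le_exp.2 (neg_le_neg (hK x))

theorem integral_eval_mul_rotMarginal (hV : IsPotential lam V) (i : Fin n)
    (h0 : ∫ x, x i * Real.exp (-V x) ∂piGaussian _ = 0) :
    ∫ x, x i * Real.exp (-_root_.rotMarginal V x) ∂piGaussian _ = 0 := by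
  have i1 := (hV.integrable_eval_mul i).mul_prod (hV.integrable (piGaussian _))
  have i2 := (hV.integrable (piGaussian _)).mul_prod (hV.integrable_eval_mul i)
  have i4 : Integrable (fun z : (Fin n → ℝ) × (Fin n → ℝ) => invSqrtTwo *
      (z.1 i * Real.exp (-V z.1) * Real.exp (-V z.2) +
        Real.exp (-V z.1) * (z.2 i * Real.exp (-V z.2)))) ((piGaussian _).prod (piGaussian _)) :=
    (i1.add i2).const_mul invSqrtTwo
  have key : ∀ z : (Fin n → ℝ) × (Fin n → ℝ), z.1 i * Real.exp (-_root_.rotSection V z.1 z.2) =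
      (fun z : (Fin n → ℝ) × (Fin n → ℝ) => invSqrtTwo *
        (z.1 i * Real.exp (-V z.1) * Real.exp (-V z.2) +
          Real.exp (-V z.1) * (z.2 i * Real.exp (-V z.2))))
        (invSqrtTwo • (z.1 - z.2), invSqrtTwo • (z.1 + z.2)) := fun z => by
    rw [exp_neg_rotSection]
    simp only [Pi.smul_apply, Pi.sub_apply, Pi.add_apply, smul_eq_mul]
    linear_combination (-2 * z.1 i * Real.exp (-V (invSqrtTwo • (z.1 - z.2))) *
      Real.exp (-V (invSqrtTwo • (z.1 + z.2)))) * invSqrtTwo_mul_self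
  have i3 : Integrable (fun z : (Fin n → ℝ) × (Fin n → ℝ) =>
      z.1 i * Real.exp (-_root_.rotSection V z.1 z.2)) ((piGaussian _).prod (piGaussian _)) := by
    simp_rw [key]
    exact integrable_prod_rotate _ integral_strongDual_piGaussian i4
  simp_rw [hV.exp_neg_rotMarginal, ← integral_const_mul]
  rw [integral_integral i3]
  rw [integral_congr_ae (Filter.Eventually.of_forall key),
    integral_prod_rotate _ integral_strongDual_piGaussian i4.aestronglyMeasurable, integral_const_mul,
    integral_add i1 i2]
  have e1 := integral_prod_mul (μ := piGaussian (Fin n)) (ν := piGaussian (Fin n))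
    (fun x : Fin n → ℝ => x i * Real.exp (-V x)) (fun x : Fin n → ℝ => Real.exp (-V x))
  have e2 := integral_prod_mul (μ := piGaussian (Fin n)) (ν := piGaussian (Fin n))
    (fun x : Fin n → ℝ => Real.exp (-V x)) (fun x : Fin n → ℝ => x i * Real.exp (-V x))
  rw [h0] at e1 e2
  rw [e1, e2]
  simp

end IsPotential

end RotMarginal

section Correlation

variable {n m : ℕ}

/-- The `ν`-integral of `∏ₐ exp (-Vₐ)`. -/
def gaussCorr (ν : Measure (Fin m → Fin n → ℝ)) (V : Fin m → (Fin n → ℝ) → ℝ) : ℝ :=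
  ∫ x, Real.exp (-∑ a, V a (x a)) ∂ν

variable {lam : ℝ} {V : Fin m → (Fin n → ℝ) → ℝ}

theorem continuous_sum_potential (hV : ∀ a, IsPotential lam (V a)) :
    Continuous fun x : Fin m → Fin n → ℝ => ∑ a, V a (x a) :=
  continuous_finsetSum _ fun a _ => (hV a).continuous.comp (continuous_apply a)

theorem integrable_exp_neg_sum (hV : ∀ a, IsPotential lam (V a))
    (ν : Measure (Fin m → Fin n → ℝ)) [IsFiniteMeasure ν] :
    Integrable (fun x => Real.exp (-∑ a, V a (x a))) ν := by
  choose K hK using fun a => (hV a).bdd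
  refine IsPotential.integrable_exp (K := -∑ a, K a)
    (continuous_sum_potential hV).neg.measurable fun x => ?_
  exact neg_le_neg (Finset.sum_le_sum fun a _ => hK a _)

theorem gaussCorr_pos (hV : ∀ a, IsPotential lam (V a))
    (ν : Measure (Fin m → Fin n → ℝ)) [IsProbabilityMeasure ν] : 0 < gaussCorr ν V :=
  integral_exp_pos (integrable_exp_neg_sum hV ν)

theorem gaussCorr_add_const (ν : Measure (Fin m → Fin n → ℝ)) (k : Fin m → ℝ) :
    gaussCorr ν (fun a x => V a x + k a) = (∏ a, Real.exp (-k a)) * gaussCorr ν V := by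
  simp_rw [gaussCorr, Finset.sum_add_distrib, neg_add_rev, Real.exp_add, integral_const_mul,
    ← Real.exp_sum, Finset.sum_neg_distrib]

theorem gaussCorr_sq (hV : ∀ a, IsPotential lam (V a)) (ν : Measure (Fin m → Fin n → ℝ))
    [IsGaussian ν] (hν : ∀ L : StrongDual ℝ (Fin m → Fin n → ℝ), ν[L] = 0) :
    Integrable (fun x : Fin m → Fin n → ℝ => gaussCorr ν fun a => rotSection (V a) (x a)) ν ∧
    gaussCorr ν V ^ 2 = ∫ x, gaussCorr ν (fun a => rotSection (V a) (x a)) ∂ν := by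
  have hi := integrable_exp_neg_sum hV ν
  have e : ∀ x y : Fin m → Fin n → ℝ, Real.exp (-∑ a, rotSection (V a) (x a) (y a)) =
      Real.exp (-∑ a, V a ((invSqrtTwo • (x - y)) a)) *
        Real.exp (-∑ a, V a ((invSqrtTwo • (x + y)) a)) := fun x y => by
    rw [← Real.exp_add, ← neg_add, ← Finset.sum_add_distrib]
    rfl
  have hr := integrable_prod_rotate _ hν (hi.mul_prod hi)
  simp_rw [gaussCorr, e]
  refine ⟨hr.integral_prod_left, ?_⟩
  rw [integral_integral hr, integral_prod_rotate _ hν (hi.mul_prod hi).aestronglyMeasurable, sq,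
    ← integral_prod_mul]

theorem mul_gaussCorr_rotMarginal_le (hV : ∀ a, IsPotential lam (V a))
    (ν : Measure (Fin m → Fin n → ℝ)) [IsGaussian ν]
    (hν : ∀ L : StrongDual ℝ (Fin m → Fin n → ℝ), ν[L] = 0) {κ : ℝ}
    (H : ∀ x : Fin m → Fin n → ℝ, κ * ∏ a, gaussMass (rotSection (V a) (x a)) ≤
      gaussCorr ν fun a => rotSection (V a) (x a)) :
    κ * gaussCorr ν (fun a => rotMarginal (V a)) ≤ gaussCorr ν V ^ 2 := by
  obtain ⟨hi, h⟩ := gaussCorr_sq hV ν hν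
  rw [h]
  conv_lhs => rw [gaussCorr, ← integral_const_mul]
  refine integral_mono
    ((integrable_exp_neg_sum (fun a => (hV a).rotMarginal) ν).const_mul κ) hi fun x => ?_
  refine le_trans (le_of_eq ?_) (H x)
  rw [← Finset.sum_neg_distrib, Real.exp_sum]
  simp_rw [(hV _).exp_neg_rotMarginal, gaussMass]

end Correlation

section EvenPotentials

variable {n : ℕ}

/-- The normalized even potentials. -/
def evenPotentials (n : ℕ) (lam : ℝ) : Set C(Fin n → ℝ, ℝ) :=
  {f | IsPotential lam f ∧ (∀ x, f (-x) = f x) ∧ f 0 = 0}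

theorem ConvexOn.apply_zero_le_of_even {U : (Fin n → ℝ) → ℝ} (hU : ConvexOn ℝ Set.univ U)
    (he : ∀ x, U (-x) = U x) (x : Fin n → ℝ) : U 0 ≤ U x := by
  have := IsPotential.convex_iff.1 hU x (-x) (1 / 2) (1 / 2) (by norm_num) (by norm_num)
    (by norm_num)
  rw [he, smul_neg, add_neg_cancel] at this
  linarith

theorem normSqPi_neg (x : Fin n → ℝ) : normSqPi (-x) = normSqPi x := by simp [normSqPi]

theorem normSqPi_zero : normSqPi (0 : Fin n → ℝ) = 0 := by simp [normSqPi]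

variable {lam : ℝ}

theorem evenPotentials_nonneg {f : C(Fin n → ℝ, ℝ)} (hf : f ∈ evenPotentials n lam)
    (x : Fin n → ℝ) : 0 ≤ f x :=
  hf.2.2 ▸ hf.1.convex.apply_zero_le_of_even hf.2.1 x

theorem evenPotentials_le {f : C(Fin n → ℝ, ℝ)} (hf : f ∈ evenPotentials n lam)
    (x : Fin n → ℝ) : f x ≤ lam / 2 * normSqPi x := by
  have := hf.1.smooth.apply_zero_le_of_even (fun x => by rw [normSqPi_neg, hf.2.1]) x
  rw [normSqPi_zero, hf.2.2] at this
  linarith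

theorem isCompact_evenPotentials (n : ℕ) (lam : ℝ) : IsCompact (evenPotentials n lam) := by
  apply ArzelaAscoli.isCompact_of_equicontinuous
  · have e : ContinuousMap.toFun '' evenPotentials n lam =
        {f | ConvexOn ℝ Set.univ f ∧ ConvexOn ℝ Set.univ (fun x => lam / 2 * normSqPi x - f x) ∧
          (∀ x, f (-x) = f x) ∧ f 0 = 0} := by
      ext f
      constructor
      · rintro ⟨g, hg, rfl⟩
        exact ⟨hg.1.convex, hg.1.smooth, hg.2⟩
      · rintro ⟨h1, h2, h3, h4⟩
        refine ⟨⟨f, h1.locallyLipschitz.continuous⟩, ⟨⟨h1, h2, 0, fun x => ?_⟩, h3, h4⟩, rfl⟩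
        rw [← h4]
        exact h1.apply_zero_le_of_even h3 x
    refine (isCompact_univ_pi fun x : Fin n → ℝ =>
      isCompact_Icc (a := (0 : ℝ)) (b := lam / 2 * normSqPi x)).of_isClosed_subset ?_ ?_
    · rw [e]
      simp only [IsPotential.convex_iff, Set.ofPred_and, Set.ofPred_forall]
      refine IsClosed.inter ?_ (IsClosed.inter ?_ (IsClosed.inter ?_ ?_))
      · exact isClosed_iInter fun x => isClosed_iInter fun y => isClosed_iInter fun a =>
          isClosed_iInter fun b => isClosed_iInter fun _ => isClosed_iInter fun _ =>
          isClosed_iInter fun _ => isClosed_le (by fun_prop) (by fun_prop)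
      · exact isClosed_iInter fun x => isClosed_iInter fun y => isClosed_iInter fun a =>
          isClosed_iInter fun b => isClosed_iInter fun _ => isClosed_iInter fun _ =>
          isClosed_iInter fun _ => isClosed_le (by fun_prop) (by fun_prop)
      · exact isClosed_iInter fun x => isClosed_eq (by fun_prop) (by fun_prop)
      · exact isClosed_eq (by fun_prop) (by fun_prop)
    · rintro _ ⟨f, hf, rfl⟩ x -
      exact ⟨evenPotentials_nonneg hf x, evenPotentials_le hf x⟩
  · intro x₀
    obtain ⟨M, hM⟩ : ∃ M, ∀ x ∈ Metric.closedBall x₀ 2, lam / 2 * normSqPi x ≤ M :=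
      (isCompact_closedBall x₀ 2).exists_bound_of_continuousOn
        (f := fun x => lam / 2 * normSqPi x) (by fun_prop) |>.imp fun M h x hx =>
          (le_abs_self _).trans (h x hx)
    set L := (2 * M).toNNReal
    refine Metric.equicontinuousAt_of_continuity_modulus (fun x => L * dist x₀ x) ?_ _ ?_
    · have : Continuous fun x => (L : ℝ) * dist x₀ x := by fun_prop
      simpa using this.tendsto x₀
    · filter_upwards [Metric.ball_mem_nhds x₀ one_pos] with x hx f
      have := (f.2.1.convex.subset (Set.subset_univ _)
        (convex_ball x₀ 2)).lipschitzOnWith_of_abs_le (ε := 1) (M := M) one_pos fun a ha => by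
          rw [abs_of_nonneg (evenPotentials_nonneg f.2 a)]
          exact (evenPotentials_le f.2 a).trans (hM a ha.le)
      rw [div_one, show (2 : ℝ) - 1 = 1 by norm_num] at this
      exact this.dist_le_mul _ (Metric.mem_ball_self one_pos) _ hx

/-- The entropy of the probability density proportional to `exp (-V)`. -/
def gaussEnt (V : (Fin n → ℝ) → ℝ) : ℝ :=
  -(∫ x, V x * Real.exp (-V x) ∂piGaussian _) / gaussMass V - Real.log (gaussMass V)

theorem integrable_mul_exp_neg {V : (Fin n → ℝ) → ℝ} (hV : Continuous V) (h0 : ∀ x, 0 ≤ V x) :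
    Integrable (fun x => V x * Real.exp (-V x)) (piGaussian _) := by
  refine Integrable.of_bound (by fun_prop) 1 (Filter.Eventually.of_forall fun x => ?_)
  rw [Real.norm_eq_abs, abs_of_nonneg (mul_nonneg (h0 x) (Real.exp_pos _).le)]
  have := Real.add_one_le_exp (V x)
  rw [Real.exp_neg, ← div_eq_mul_inv, div_le_one (Real.exp_pos _)]
  linarith

theorem gaussEnt_add_const {V : (Fin n → ℝ) → ℝ} (hV : IsPotential lam V) (h0 : ∀ x, 0 ≤ V x)
    (k : ℝ) : gaussEnt (fun x => V x + k) = gaussEnt V := by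
  have e : ∀ x, (V x + k) * Real.exp (-(V x + k)) =
      Real.exp (-k) * (V x * Real.exp (-V x) + k * Real.exp (-V x)) := fun x => by
    rw [neg_add, Real.exp_add]
    ring
  simp_rw [gaussEnt, gaussMass_add_const, e, integral_const_mul]
  rw [integral_add (integrable_mul_exp_neg hV.continuous h0) ((hV.integrable _).const_mul _),
    integral_const_mul, Real.log_mul (Real.exp_pos _).ne' hV.gaussMass_pos.ne', Real.log_exp]
  have := hV.gaussMass_pos
  have h : ∫ x, Real.exp (-V x) ∂piGaussian _ = gaussMass V := rfl
  rw [h]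
  field_simp
  ring

theorem continuousOn_gaussMass :
    ContinuousOn (fun f : C(Fin n → ℝ, ℝ) => gaussMass f) (evenPotentials n lam) := by
  refine continuousOn_of_dominated (bound := fun _ => 1) (fun f _ => by fun_prop) (fun f hf => ?_)
    (integrable_const _) (Filter.Eventually.of_forall fun x => Continuous.continuousOn (by fun_prop))
  refine Filter.Eventually.of_forall fun x => ?_
  rw [Real.norm_eq_abs, Real.abs_exp, Real.exp_le_one_iff]
  exact neg_nonpos.2 (evenPotentials_nonneg hf x)

theorem continuousOn_gaussEnt :
    ContinuousOn (fun f : C(Fin n → ℝ, ℝ) => gaussEnt f) (evenPotentials n lam) := by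
  refine ContinuousOn.sub (ContinuousOn.div (ContinuousOn.neg ?_) continuousOn_gaussMass
    fun f hf => hf.1.gaussMass_pos.ne') (continuousOn_gaussMass.log
    fun f hf => hf.1.gaussMass_pos.ne')
  refine continuousOn_of_dominated (bound := fun _ => 1) (fun f _ => by fun_prop) (fun f hf => ?_)
    (integrable_const _) (Filter.Eventually.of_forall fun x => Continuous.continuousOn (by fun_prop))
  refine Filter.Eventually.of_forall fun x => ?_
  have h0 := evenPotentials_nonneg hf x
  rw [Real.norm_eq_abs, abs_of_nonneg (mul_nonneg h0 (Real.exp_pos _).le)]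
  have := Real.add_one_le_exp (f x)
  rw [Real.exp_neg, ← div_eq_mul_inv, div_le_one (Real.exp_pos _)]
  linarith

theorem continuousOn_gaussCorr {m : ℕ} (ν : Measure (Fin m → Fin n → ℝ)) [IsFiniteMeasure ν] :
    ContinuousOn (fun f : Fin m → C(Fin n → ℝ, ℝ) => gaussCorr ν fun a => f a)
      (Set.univ.pi fun _ => evenPotentials n lam) := by
  refine continuousOn_of_dominated (bound := fun _ => 1) (fun f _ => ?_) (fun f hf => ?_)
    (integrable_const _) (Filter.Eventually.of_forall fun x => ?_)
  · have : Continuous fun x : Fin m → Fin n → ℝ => Real.exp (-∑ a, f a (x a)) := by fun_prop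
    exact this.aestronglyMeasurable
  · refine Filter.Eventually.of_forall fun x => ?_
    rw [Real.norm_eq_abs, Real.abs_exp, Real.exp_le_one_iff]
    exact neg_nonpos.2 (Finset.sum_nonneg fun a _ => evenPotentials_nonneg (hf a trivial) _)
  · have : Continuous fun f : Fin m → C(Fin n → ℝ, ℝ) => Real.exp (-∑ a, f a (x a)) := by fun_prop
    exact this.continuousOn

theorem zero_mem_evenPotentials (hlam : 0 ≤ lam) : (0 : C(Fin n → ℝ, ℝ)) ∈ evenPotentials n lam := by
  refine ⟨⟨convexOn_const 0 convex_univ, ?_, 0, fun _ => le_rfl⟩, fun _ => rfl, rfl⟩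
  rw [IsPotential.convex_iff]
  intro x y a b ha hb hab
  obtain rfl : b = 1 - a := by linarith
  simp only [ContinuousMap.coe_zero, Pi.zero_apply, sub_zero, normSqPi, Finset.mul_sum,
    ← Finset.sum_add_distrib]
  refine Finset.sum_le_sum fun i _ => ?_
  simp only [Pi.add_apply, Pi.smul_apply, smul_eq_mul]
  nlinarith [mul_nonneg (mul_nonneg (mul_nonneg hlam ha.le) hb.le) (sq_nonneg (x i - y i))]

theorem exists_minimal_evenPotentials {m : ℕ} (ν : Measure (Fin m → Fin n → ℝ))
    [IsProbabilityMeasure ν] (hlam : 0 ≤ lam) :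
    ∃ f : Fin m → C(Fin n → ℝ, ℝ), (∀ a, f a ∈ evenPotentials n lam) ∧
      (∀ g : Fin m → C(Fin n → ℝ, ℝ), (∀ a, g a ∈ evenPotentials n lam) →
        gaussCorr ν (fun a => f a) / ∏ a, gaussMass (f a) ≤
          gaussCorr ν (fun a => g a) / ∏ a, gaussMass (g a)) ∧
      (∀ g : Fin m → C(Fin n → ℝ, ℝ), (∀ a, g a ∈ evenPotentials n lam) →
        gaussCorr ν (fun a => g a) / ∏ a, gaussMass (g a) ≤
          gaussCorr ν (fun a => f a) / ∏ a, gaussMass (f a) →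
        ∑ a, gaussEnt (f a) ≤ ∑ a, gaussEnt (g a)) := by
  set S : Set (Fin m → C(Fin n → ℝ, ℝ)) := Set.univ.pi fun _ => evenPotentials n lam with hS
  have hSc : IsCompact S := isCompact_univ_pi fun _ => isCompact_evenPotentials n lam
  have hS0 : S.Nonempty := ⟨fun _ => 0, fun _ _ => zero_mem_evenPotentials hlam⟩
  have ev : ∀ a, Set.MapsTo (fun f : Fin m → C(Fin n → ℝ, ℝ) => f a) S (evenPotentials n lam) :=
    fun a f hf => hf a trivial
  set Ψ : (Fin m → C(Fin n → ℝ, ℝ)) → ℝ := fun f =>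
    gaussCorr ν (fun a => f a) / ∏ a, gaussMass (f a) with hΨ
  have hcont : ContinuousOn Ψ S := by
    refine (continuousOn_gaussCorr ν).div (continuousOn_finsetProd _ fun a _ =>
      continuousOn_gaussMass.comp (by fun_prop) (ev a)) fun f hf => ?_
    exact Finset.prod_ne_zero_iff.2 fun a _ => (hf a trivial).1.gaussMass_pos.ne'
  obtain ⟨f₀, hf₀, hmin₀⟩ := hSc.exists_isMinOn hS0 hcont
  have hS'c : IsCompact (S ∩ Ψ ⁻¹' Set.Iic (Ψ f₀)) :=
    hSc.of_isClosed_subset (hcont.preimage_isClosed_of_isClosed hSc.isClosed isClosed_Iic)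
      Set.inter_subset_left
  have hJ : ContinuousOn (fun f : Fin m → C(Fin n → ℝ, ℝ) => ∑ a, gaussEnt (f a)) S :=
    continuousOn_finsetSum _ fun a _ => continuousOn_gaussEnt.comp (by fun_prop) (ev a)
  obtain ⟨f, ⟨hf, hf'⟩, hmin⟩ := hS'c.exists_isMinOn ⟨f₀, hf₀, le_refl (Ψ f₀)⟩
    (hJ.mono Set.inter_subset_left)
  refine ⟨f, fun a => hf a trivial, fun g hg => ?_, fun g hg hgf => ?_⟩
  · exact le_trans hf' (hmin₀ (a := g) fun a _ => hg a)
  · exact hmin (a := g) ⟨fun a _ => hg a, hgf.trans hf'⟩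

end EvenPotentials

section EntropyRigidity

variable {n : ℕ} {lam : ℝ} {V : (Fin n → ℝ) → ℝ}

instance isOpenPosMeasure_piGaussian (ι : Type*) [Fintype ι] :
    (piGaussian ι).IsOpenPosMeasure := by
  have : (gaussianReal 0 1).IsOpenPosMeasure :=
    (gaussianReal_absolutelyContinuous' 0 one_ne_zero).isOpenPosMeasure
  unfold piGaussian
  infer_instance

theorem rotSection_swap (hV : ∀ x, V (-x) = V x) (x y : Fin n → ℝ) :
    rotSection V x y = rotSection V y x := by
  have e1 : invSqrtTwo • (y - x) = -(invSqrtTwo • (x - y)) := by module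
  rw [rotSection, rotSection, e1, hV, add_comm x y]

theorem rotMarginal_nonneg (hV : IsPotential lam V) (h0 : ∀ x, 0 ≤ V x) (x : Fin n → ℝ) :
    0 ≤ rotMarginal V x := by
  refine neg_nonneg.2 (Real.log_nonpos (hV.rotSection x).integral_pos.le ?_)
  calc _ ≤ ∫ y : Fin n → ℝ, (1 : ℝ) ∂piGaussian _ :=
        integral_mono ((hV.rotSection x).integrable _) (integrable_const _) fun y => by
          rw [Real.exp_le_one_iff]
          exact neg_nonpos.2 (add_nonneg (h0 _) (h0 _))
    _ = 1 := by simp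

theorem relEntropy_integrand_nonneg (s t : ℝ) :
    0 ≤ Real.exp (-s) * (t - s) - Real.exp (-s) + Real.exp (-t) := by
  have h : Real.exp (-t) = Real.exp (-s) * Real.exp (s - t) := by rw [← Real.exp_add]; ring_nf
  rw [h]
  nlinarith [Real.exp_pos (-s), Real.add_one_le_exp (s - t)]

theorem eq_of_relEntropy_integrand_eq_zero {s t : ℝ}
    (hst : Real.exp (-s) * (t - s) - Real.exp (-s) + Real.exp (-t) = 0) : s = t := by
  by_contra hne
  have h : Real.exp (-t) = Real.exp (-s) * Real.exp (s - t) := by rw [← Real.exp_add]; ring_nf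
  rw [h] at hst
  nlinarith [Real.exp_pos (-s), Real.add_one_lt_exp (sub_ne_zero.2 hne)]

theorem integral_relEntropy (hV : IsPotential lam V) (he : ∀ x, V (-x) = V x)
    (h0 : ∀ x, 0 ≤ V x) :
    Integrable (fun z : (Fin n → ℝ) × (Fin n → ℝ) =>
      Real.exp (-rotSection V z.1 z.2) *
        (rotMarginal V z.1 + rotMarginal V z.2 + 2 * Real.log (gaussMass V) -
          rotSection V z.1 z.2) - Real.exp (-rotSection V z.1 z.2) +
        Real.exp (-(rotMarginal V z.1 + rotMarginal V z.2 + 2 * Real.log (gaussMass V))))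
      ((piGaussian _).prod (piGaussian _)) ∧
    ∫ z : (Fin n → ℝ) × (Fin n → ℝ),
      (Real.exp (-rotSection V z.1 z.2) *
        (rotMarginal V z.1 + rotMarginal V z.2 + 2 * Real.log (gaussMass V) -
          rotSection V z.1 z.2) - Real.exp (-rotSection V z.1 z.2) +
        Real.exp (-(rotMarginal V z.1 + rotMarginal V z.2 + 2 * Real.log (gaussMass V))))
      ∂(piGaussian _).prod (piGaussian _) =
      2 * gaussMass V ^ 2 * (gaussEnt V - gaussEnt (rotMarginal V)) := by
  have hZ := hV.gaussMass_pos
  have hT := hV.rotMarginal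
  have hT0 := rotMarginal_nonneg hV h0
  have hc := hV.continuous_rotSection
  have hTc := hT.continuous
  set γ := piGaussian (Fin n)
  set f : (Fin n → ℝ) × (Fin n → ℝ) → ℝ := fun z => Real.exp (-rotSection V z.1 z.2) with hf
  have if0 : Integrable f (γ.prod γ) := hV.integrable_rotSection
  have ef0 : ∫ z, f z ∂γ.prod γ = gaussMass V ^ 2 := by
    rw [← hV.gaussMass_rotMarginal, integral_prod _ if0]
    simp_rw [gaussMass, hV.exp_neg_rotMarginal]
    rfl
  have inner : ∀ x, ∫ y, rotMarginal V x * f (x, y) ∂γ =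
      rotMarginal V x * Real.exp (-rotMarginal V x) := fun x => by
    rw [integral_const_mul, hV.exp_neg_rotMarginal]
  have if1 : Integrable (fun z => rotMarginal V z.1 * f z) (γ.prod γ) := by
    rw [integrable_prod_iff (by fun_prop)]
    refine ⟨Filter.Eventually.of_forall fun x => by
      simpa only [hf] using ((hV.rotSection x).integrable γ).const_mul (rotMarginal V x), ?_⟩
    refine (integrable_mul_exp_neg hTc hT0).congr (Filter.Eventually.of_forall fun x => ?_)
    beta_reduce
    rw [← inner x]
    refine integral_congr_ae (Filter.Eventually.of_forall fun y => ?_)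
    exact (Real.norm_of_nonneg (mul_nonneg (hT0 x) (Real.exp_pos _).le)).symm
  have ef1 : ∫ z, rotMarginal V z.1 * f z ∂γ.prod γ =
      ∫ x, rotMarginal V x * Real.exp (-rotMarginal V x) ∂γ := by
    rw [integral_prod _ if1]
    simp_rw [inner]
  have sw : (fun z => rotMarginal V z.2 * f z) =
      (fun z => rotMarginal V z.1 * f z) ∘ Prod.swap := by
    funext z
    simp [hf, rotSection_swap he z.1 z.2]
  have if2 : Integrable (fun z => rotMarginal V z.2 * f z) (γ.prod γ) := by
    rw [sw]
    exact if1.swap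
  have ef2 : ∫ z, rotMarginal V z.2 * f z ∂γ.prod γ =
      ∫ x, rotMarginal V x * Real.exp (-rotMarginal V x) ∂γ := by
    rw [← ef1, sw]
    exact integral_prod_swap (fun z => rotMarginal V z.1 * f z)
  have iV := integrable_mul_exp_neg hV.continuous h0
  have iE := hV.integrable γ
  have ig : Integrable (fun z : (Fin n → ℝ) × (Fin n → ℝ) =>
      V z.1 * Real.exp (-V z.1) * Real.exp (-V z.2) +
        Real.exp (-V z.1) * (V z.2 * Real.exp (-V z.2))) (γ.prod γ) :=
    (iV.mul_prod iE).add (iE.mul_prod iV)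
  have es : ∀ z : (Fin n → ℝ) × (Fin n → ℝ), rotSection V z.1 z.2 * f z =
      (fun z : (Fin n → ℝ) × (Fin n → ℝ) =>
      V z.1 * Real.exp (-V z.1) * Real.exp (-V z.2) +
        Real.exp (-V z.1) * (V z.2 * Real.exp (-V z.2)))
      (invSqrtTwo • (z.1 - z.2), invSqrtTwo • (z.1 + z.2)) := fun z => by
    simp only [hf]
    rw [exp_neg_rotSection, rotSection]
    ring
  have if3 : Integrable (fun z => rotSection V z.1 z.2 * f z) (γ.prod γ) := by
    simp_rw [es]
    exact integrable_prod_rotate _ integral_strongDual_piGaussian ig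
  have ef3 : ∫ z, rotSection V z.1 z.2 * f z ∂γ.prod γ =
      2 * gaussMass V * ∫ x, V x * Real.exp (-V x) ∂γ := by
    rw [integral_congr_ae (Filter.Eventually.of_forall es),
      integral_prod_rotate _ integral_strongDual_piGaussian ig.aestronglyMeasurable,
      integral_add (iV.mul_prod iE) (iE.mul_prod iV)]
    have e1 := integral_prod_mul (μ := γ) (ν := γ)
      (fun x : Fin n → ℝ => V x * Real.exp (-V x)) (fun x : Fin n → ℝ => Real.exp (-V x))
    have e2 := integral_prod_mul (μ := γ) (ν := γ)
      (fun x : Fin n → ℝ => Real.exp (-V x)) (fun x : Fin n → ℝ => V x * Real.exp (-V x))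
    rw [e1, e2, gaussMass]
    ring
  have eq : ∀ z : (Fin n → ℝ) × (Fin n → ℝ),
      Real.exp (-(rotMarginal V z.1 + rotMarginal V z.2 + 2 * Real.log (gaussMass V))) =
      (gaussMass V ^ 2)⁻¹ * (Real.exp (-rotMarginal V z.1) * Real.exp (-rotMarginal V z.2)) := by
    intro z
    rw [← Real.exp_log (by positivity : 0 < (gaussMass V ^ 2)⁻¹), ← Real.exp_add, ← Real.exp_add,
      Real.log_inv, Real.log_pow]
    push_cast
    ring_nf
  have iT := hT.integrable γ
  have if4 : Integrable (fun z : (Fin n → ℝ) × (Fin n → ℝ) =>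
      Real.exp (-(rotMarginal V z.1 + rotMarginal V z.2 + 2 * Real.log (gaussMass V))))
      (γ.prod γ) := by
    simp_rw [eq]
    exact (iT.mul_prod iT).const_mul _
  have ef4 : ∫ z : (Fin n → ℝ) × (Fin n → ℝ),
      Real.exp (-(rotMarginal V z.1 + rotMarginal V z.2 + 2 * Real.log (gaussMass V)))
      ∂γ.prod γ = gaussMass V ^ 2 := by
    have e1 := integral_prod_mul (μ := γ) (ν := γ)
      (fun x : Fin n → ℝ => Real.exp (-rotMarginal V x))
      (fun x : Fin n → ℝ => Real.exp (-rotMarginal V x))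
    have e2 : ∫ x, Real.exp (-rotMarginal V x) ∂γ = gaussMass V ^ 2 := hV.gaussMass_rotMarginal
    simp_rw [eq]
    rw [integral_const_mul, e1, e2]
    field_simp
  have split : (fun z : (Fin n → ℝ) × (Fin n → ℝ) =>
      f z * (rotMarginal V z.1 + rotMarginal V z.2 + 2 * Real.log (gaussMass V) -
          rotSection V z.1 z.2) - f z +
        Real.exp (-(rotMarginal V z.1 + rotMarginal V z.2 + 2 * Real.log (gaussMass V)))) =
      fun z => rotMarginal V z.1 * f z + rotMarginal V z.2 * f z +
        (2 * Real.log (gaussMass V) - 1) * f z - rotSection V z.1 z.2 * f z +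
        Real.exp (-(rotMarginal V z.1 + rotMarginal V z.2 + 2 * Real.log (gaussMass V))) := by
    funext z
    ring
  have i12 : Integrable (fun z => rotMarginal V z.1 * f z + rotMarginal V z.2 * f z) (γ.prod γ) :=
    if1.add if2
  have i120 : Integrable (fun z => rotMarginal V z.1 * f z + rotMarginal V z.2 * f z +
      (2 * Real.log (gaussMass V) - 1) * f z) (γ.prod γ) := i12.add (if0.const_mul _)
  have i1203 : Integrable (fun z => rotMarginal V z.1 * f z + rotMarginal V z.2 * f z +
      (2 * Real.log (gaussMass V) - 1) * f z - rotSection V z.1 z.2 * f z) (γ.prod γ) :=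
    i120.sub if3
  rw [split]
  refine ⟨i1203.add if4, ?_⟩
  rw [integral_add i1203 if4, integral_sub i120 if3, integral_add i12 (if0.const_mul _),
    integral_add if1 if2, integral_const_mul, ef0, ef1, ef2, ef3, ef4, gaussEnt, gaussEnt,
    hV.gaussMass_rotMarginal, Real.log_pow]
  field_simp
  push_cast
  ring

theorem gaussEnt_rotMarginal_le (hV : IsPotential lam V) (he : ∀ x, V (-x) = V x)
    (h0 : ∀ x, 0 ≤ V x) : gaussEnt (rotMarginal V) ≤ gaussEnt V := by
  obtain ⟨-, h⟩ := integral_relEntropy hV he h0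
  have h1 := integral_nonneg (μ := (piGaussian (Fin n)).prod (piGaussian (Fin n)))
    (f := fun z : (Fin n → ℝ) × (Fin n → ℝ) =>
      Real.exp (-rotSection V z.1 z.2) *
        (rotMarginal V z.1 + rotMarginal V z.2 + 2 * Real.log (gaussMass V) -
          rotSection V z.1 z.2) - Real.exp (-rotSection V z.1 z.2) +
        Real.exp (-(rotMarginal V z.1 + rotMarginal V z.2 + 2 * Real.log (gaussMass V))))
    fun z => relEntropy_integrand_nonneg _ _
  rw [h] at h1
  have hZ := hV.gaussMass_pos
  have := nonneg_of_mul_nonneg_right h1 (by positivity)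
  linarith

theorem rotSection_eq_of_gaussEnt_le (hV : IsPotential lam V) (he : ∀ x, V (-x) = V x)
    (h0 : ∀ x, 0 ≤ V x) (hle : gaussEnt V ≤ gaussEnt (rotMarginal V)) (x y : Fin n → ℝ) :
    rotSection V x y = rotMarginal V x + rotMarginal V y + 2 * Real.log (gaussMass V) := by
  obtain ⟨hi, h⟩ := integral_relEntropy hV he h0
  have heq : gaussEnt V - gaussEnt (rotMarginal V) = 0 :=
    sub_eq_zero.2 (le_antisymm hle (gaussEnt_rotMarginal_le hV he h0))
  rw [heq, mul_zero, integral_eq_zero_iff_of_nonneg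
    (fun z => relEntropy_integrand_nonneg _ _) hi] at h
  have hc := hV.continuous_rotSection
  have hTc := hV.rotMarginal.continuous
  have := (Continuous.ae_eq_iff_eq _ (by fun_prop) continuous_zero).1 h
  exact eq_of_relEntropy_integrand_eq_zero (congrFun this (x, y))

theorem parallelogram_of_gaussEnt_le (hV : IsPotential lam V) (he : ∀ x, V (-x) = V x)
    (hV0 : V 0 = 0) (hle : gaussEnt V ≤ gaussEnt (rotMarginal V)) (x y : Fin n → ℝ) :
    V (x - y) + V (x + y) = 2 * V x + 2 * V y := by
  have h0 : ∀ x, 0 ≤ V x := fun x => hV0 ▸ hV.convex.apply_zero_le_of_even he x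
  have key := rotSection_eq_of_gaussEnt_le hV he h0 hle
  have hs : invSqrtTwo ≠ 0 := fun h => by
    have := invSqrtTwo_mul_self
    rw [h] at this
    norm_num at this
  have k0 := key 0 0
  have kx := key (invSqrtTwo⁻¹ • x) 0
  have ky := key (invSqrtTwo⁻¹ • y) 0
  have kxy := key (invSqrtTwo⁻¹ • x) (invSqrtTwo⁻¹ • y)
  simp only [rotSection, smul_sub, smul_add, smul_zero, smul_inv_smul₀ hs, sub_zero, add_zero,
    hV0] at k0 kx ky kxy
  linarith

end EntropyRigidity

section Quadratic

variable {n : ℕ}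

open scoped MatrixOrder in
theorem Matrix.PosSemidef.exists_transpose_mul_self {M : Matrix (Fin n) (Fin n) ℝ}
    (h : M.PosSemidef) : ∃ A : Matrix (Fin n) (Fin n) ℝ, M = Aᵀ * A := by
  obtain ⟨A, hA⟩ := CStarAlgebra.nonneg_iff_eq_star_mul_self.1 h.nonneg
  exact ⟨A, by rw [hA, star_eq_conjTranspose, conjTranspose_eq_transpose_of_trivial]⟩

theorem exists_matrix_of_parallelogram {V : (Fin n → ℝ) → ℝ} (hc : Continuous V)
    (h0 : ∀ x, 0 ≤ V x) (hp : ∀ x y, V (x - y) + V (x + y) = 2 * V x + 2 * V y) :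
    ∃ A : Matrix (Fin n) (Fin n) ℝ, ∀ x, V x = (∑ i, (A *ᵥ x) i ^ 2) / 2 := by
  have hV0 : V 0 = 0 := by
    have := hp 0 0
    simp only [sub_zero, add_zero] at this
    linarith
  have he : ∀ x, V (-x) = V x := fun x => by
    have := hp 0 x
    simp only [zero_sub, zero_add] at this
    linarith
  set D : (Fin n → ℝ) → (Fin n → ℝ) → ℝ := fun x y => (V (x + y) - V (x - y)) / 2 with hD
  have hDs : ∀ x y, D x y = D y x := fun x y => by
    have := he (x - y)
    rw [neg_sub] at this
    simp only [hD, this, add_comm]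
  have hD2 : ∀ x y z, D (x + z) y + D (x - z) y = 2 * D x y := fun x y z => by
    have h1 := hp (x + y) z
    have h2 := hp (x - y) z
    simp only [hD]
    rw [show x + z + y = x + y + z by abel, show x + z - y = x - y + z by abel,
      show x - z + y = x + y - z by abel, show x - z - y = x - y - z by abel]
    linarith
  have hD0 : ∀ y, D 0 y = 0 := fun y => by simp [hD, he]
  have hDadd : ∀ u w y, D (u + w) y = D u y + D w y := fun u w y => by
    have h1 := hD2 ((1 / 2 : ℝ) • (u + w)) y ((1 / 2 : ℝ) • (u - w))
    have h2 := hD2 ((1 / 2 : ℝ) • (u + w)) y ((1 / 2 : ℝ) • (u + w))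
    rw [show (1 / 2 : ℝ) • (u + w) + (1 / 2 : ℝ) • (u - w) = u by module,
      show (1 / 2 : ℝ) • (u + w) - (1 / 2 : ℝ) • (u - w) = w by module] at h1
    rw [show (1 / 2 : ℝ) • (u + w) + (1 / 2 : ℝ) • (u + w) = u + w by module, sub_self, hD0] at h2
    linarith
  have hDsmul : ∀ (c : ℝ) u y, D (c • u) y = c * D u y := fun c u y => by
    have hcont : Continuous fun u => D u y := by fun_prop
    exact ((AddMonoidHom.mk' (fun u => D u y) fun u w => hDadd u w y).toRealLinearMap
      hcont).map_smul c u
  let b : (Fin n → ℝ) →ₗ[ℝ] (Fin n → ℝ) →ₗ[ℝ] ℝ :=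
    LinearMap.mk₂ ℝ D hDadd hDsmul
      (fun x u w => by rw [hDs, hDadd, hDs u, hDs w])
      (fun c x u => by rw [hDs, hDsmul, hDs u, smul_eq_mul])
  set M := LinearMap.toMatrix₂' ℝ b with hM
  have hMb : ∀ x y, D x y = x ⬝ᵥ M *ᵥ y := fun x y => by
    have := Matrix.toLinearMap₂'_apply' M x y
    rw [hM, Matrix.toLinearMap₂'_toMatrix'] at this
    exact this
  have hxx : ∀ x, D x x = 2 * V x := fun x => by
    have := hp x x
    simp only [hD, sub_self, hV0] at this ⊢
    linarith
  have hPSD : M.PosSemidef := by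
    refine .of_dotProduct_mulVec_nonneg ?_ fun x => ?_
    · ext i j
      simp only [conjTranspose_apply, star_trivial, hM, LinearMap.toMatrix₂'_apply]
      exact hDs _ _
    · rw [star_trivial, ← hMb, hxx]
      linarith [h0 x]
  obtain ⟨A, hA⟩ := hPSD.exists_transpose_mul_self
  refine ⟨A, fun x => ?_⟩
  have := hMb x x
  rw [hxx, hA, ← mulVec_mulVec, dotProduct_mulVec, vecMul_transpose] at this
  simp only [dotProduct, ← sq] at this
  linarith

end Quadratic

section GaussianSwap

variable {X Y : Type*} [NormedAddCommGroup X] [NormedSpace ℝ X] [MeasurableSpace X]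
  [BorelSpace X] [SecondCountableTopology X] [NormedAddCommGroup Y]
  [NormedSpace ℝ Y] [MeasurableSpace Y] [BorelSpace Y] [SecondCountableTopology Y]

theorem integral_exp_variance_swap (μ : Measure X) [IsGaussian μ] (ν : Measure Y) [IsGaussian ν]
    (hμ : ∀ L : StrongDual ℝ X, μ[L] = 0) (hν : ∀ L : StrongDual ℝ Y, ν[L] = 0)
    (b : X →L[ℝ] Y →L[ℝ] ℝ) :
    Integrable (fun x => Real.exp (-Var[b x; ν] / 2)) μ ∧
    ∫ x, Real.exp (-Var[b x; ν] / 2) ∂μ = ∫ y, Real.exp (-Var[b.flip y; μ] / 2) ∂ν := by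
  have hb : Continuous fun z : X × Y => b z.1 z.2 := by fun_prop
  have hi : Integrable (fun z : X × Y => Complex.exp (b z.1 z.2 * Complex.I)) (μ.prod ν) := by
    refine Integrable.of_bound (by fun_prop) 1 (Filter.Eventually.of_forall fun z => ?_)
    rw [Complex.norm_exp_ofReal_mul_I]
  have h1 : ∀ x, ∫ y, Complex.exp (b x y * Complex.I) ∂ν = (Real.exp (-Var[b x; ν] / 2) : ℝ) :=
    fun x => by
      have := IsGaussian.charFunDual_eq_of_forall_strongDual_eq_zero hν (b x)
      rw [charFunDual_apply] at this
      rw [this]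
      push_cast
      rfl
  have h2 : ∀ y, ∫ x, Complex.exp (b x y * Complex.I) ∂μ =
      (Real.exp (-Var[b.flip y; μ] / 2) : ℝ) :=
    fun y => by
      have := IsGaussian.charFunDual_eq_of_forall_strongDual_eq_zero hμ (b.flip y)
      rw [charFunDual_apply] at this
      simp only [ContinuousLinearMap.flip_apply] at this
      rw [this]
      push_cast
      rfl
  have hs := integral_integral_swap
    (f := fun x y => Complex.exp (b x y * Complex.I)) hi
  have hi1 := hi.integral_prod_left
  simp only [h1] at hs hi1
  simp only [h2] at hs
  rw [integral_complex_ofReal, integral_complex_ofReal] at hs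
  refine ⟨?_, Complex.ofReal_injective hs⟩
  exact hi1.re

end GaussianSwap

section BlockGaussian

variable {n m : ℕ}

/-- The standard Gaussian measure on `Fin m → Fin n → ℝ`. -/
def blockGaussian (m n : ℕ) : Measure (Fin m → Fin n → ℝ) :=
  Measure.pi fun _ => piGaussian (Fin n)

instance isProbabilityMeasure_blockGaussian (m n : ℕ) :
    IsProbabilityMeasure (blockGaussian m n) := by
  unfold blockGaussian
  infer_instance

theorem measurePreserving_eval_blockGaussian (a : Fin m) :
    MeasurePreserving (fun x : Fin m → Fin n → ℝ => x a) (blockGaussian m n)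
      (piGaussian (Fin n)) :=
  measurePreserving_eval (fun _ => piGaussian (Fin n)) a

instance isGaussian_blockGaussian (m n : ℕ) : IsGaussian (blockGaussian m n) := by
  have h1 : iIndepFun (fun (a : Fin m) (x : Fin m → Fin n → ℝ) => x a) (blockGaussian m n) :=
    iIndepFun_pi (X := fun _ x => x) fun _ => aemeasurable_id
  have h2 : ∀ a : Fin m, HasGaussianLaw (fun x : Fin m → Fin n → ℝ => x a) (blockGaussian m n) :=
    fun a => ⟨by rw [(measurePreserving_eval_blockGaussian a).map_eq]; infer_instance⟩
  have := (h1.hasGaussianLaw h2).isGaussian_map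
  simpa using this

theorem integral_strongDual_blockGaussian (L : StrongDual ℝ (Fin m → Fin n → ℝ)) :
    (blockGaussian m n)[L] = 0 := by
  have hL : ∀ x, L x = ∑ a, (L ∘L ContinuousLinearMap.single ℝ (fun _ => Fin n → ℝ) a) (x a) :=
    fun x => by
      simp only [ContinuousLinearMap.coe_comp, Function.comp_apply, ← map_sum]
      congr 1
      exact (Finset.univ_sum_single x).symm
  have hint : ∀ (a : Fin m) (l : StrongDual ℝ (Fin n → ℝ)),
      Integrable (fun x : Fin m → Fin n → ℝ => l (x a)) (blockGaussian m n) := fun a l =>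
    (measurePreserving_eval_blockGaussian a).integrable_comp_of_integrable
      (IsGaussian.integrable_dual _ l)
  rw [integral_congr_ae (Filter.Eventually.of_forall hL), integral_finsetSum _ fun a _ => hint a _]
  refine Finset.sum_eq_zero fun a _ => ?_
  have h := integral_map (μ := blockGaussian m n) (φ := fun x : Fin m → Fin n → ℝ => x a)
    (f := L ∘L ContinuousLinearMap.single ℝ (fun _ => Fin n → ℝ) a)
    (measurable_pi_apply a).aemeasurable (by fun_prop)
  rw [← h, (measurePreserving_eval_blockGaussian a).map_eq, integral_strongDual_piGaussian]

theorem gaussCorr_blockGaussian (V : Fin m → (Fin n → ℝ) → ℝ) :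
    gaussCorr (blockGaussian m n) V = ∏ a, gaussMass (V a) := by
  simp_rw [gaussCorr, ← Finset.sum_neg_distrib, Real.exp_sum]
  exact integral_fintype_prod_eq_prod (fun a x => Real.exp (-V a x))

/-- The bilinear form `(x, y) ↦ ⟪x a, A y a⟫`. -/
def blockTerm (A : Matrix (Fin n) (Fin n) ℝ) (a : Fin m) :
    (Fin m → Fin n → ℝ) →L[ℝ] (Fin m → Fin n → ℝ) →L[ℝ] ℝ :=
  (LinearMap.mk₂ ℝ (fun x y : Fin m → Fin n → ℝ => x a ⬝ᵥ A *ᵥ y a)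
    (fun _ _ _ => by simp [add_dotProduct]) (fun _ _ _ => by simp [smul_dotProduct])
    (fun _ _ _ => by simp [mulVec_add, dotProduct_add])
    (fun _ _ _ => by simp [mulVec_smul, dotProduct_smul])).toContinuousBilinearMap

theorem blockTerm_apply (A : Matrix (Fin n) (Fin n) ℝ) (a : Fin m) (x y : Fin m → Fin n → ℝ) :
    blockTerm A a x y = x a ⬝ᵥ A *ᵥ y a := rfl

theorem variance_dotProduct_piGaussian (v : Fin n → ℝ) :
    Var[fun x => x ⬝ᵥ v; piGaussian (Fin n)] = ∑ i, v i ^ 2 := by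
  have h : (fun x => x ⬝ᵥ v) = ∑ i, fun x : Fin n → ℝ => (fun t => t * v i) (x i) := by
    funext x
    simp [dotProduct]
  rw [h, piGaussian, variance_sum_pi (X := fun i t => t * v i) fun i => ?_]
  · refine Finset.sum_congr rfl fun i _ => ?_
    rw [variance_mul_const, variance_fun_id_gaussianReal]
    simp
  · exact (memLp_id_gaussianReal 2).mul_const _

theorem variance_sum_blockGaussian (l : Fin m → StrongDual ℝ (Fin n → ℝ)) :
    Var[fun x => ∑ a, l a (x a); blockGaussian m n] = ∑ a, Var[l a; piGaussian (Fin n)] := by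
  rw [← variance_sum_pi (X := fun a x => l a x) fun a => IsGaussian.memLp_dual _ (l a) 2 (by simp)]
  congr 1
  funext x
  simp

theorem variance_sum_blockTerm_flip (A : Fin m → Matrix (Fin n) (Fin n) ℝ)
    (y : Fin m → Fin n → ℝ) :
    Var[(∑ a, blockTerm (A a) a).flip y; blockGaussian m n] =
      ∑ a, ∑ i, (A a *ᵥ y a) i ^ 2 := by
  simp_rw [← variance_dotProduct_piGaussian]
  rw [blockGaussian, ← variance_sum_pi (X := fun a x => x ⬝ᵥ A a *ᵥ y a) fun a => ?_]
  · congr 1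
    funext x
    simp [blockTerm_apply]
  · have := IsGaussian.memLp_dual (piGaussian (Fin n))
      (LinearMap.toContinuousLinearMap (dotProductBilin ℝ ℝ |>.flip (A a *ᵥ y a))) 2 (by simp)
    exact this

/-- The measure `ν` is a centered Gaussian measure on `Fin m → Fin n → ℝ` all of whose blocks are
standard. -/
structure IsStdBlockGaussian (ν : Measure (Fin m → Fin n → ℝ)) : Prop where
  gaussian : IsGaussian ν
  centered : ∀ L : StrongDual ℝ (Fin m → Fin n → ℝ), ν[L] = 0
  block : ∀ a, ν.map (fun x => x a) = piGaussian (Fin n)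

theorem isStdBlockGaussian_blockGaussian : IsStdBlockGaussian (blockGaussian m n) :=
  ⟨inferInstance, integral_strongDual_blockGaussian,
    fun a => (measurePreserving_eval_blockGaussian a).map_eq⟩

theorem IsStdBlockGaussian.variance_blockTerm {ν : Measure (Fin m → Fin n → ℝ)}
    (hν : IsStdBlockGaussian ν) (A : Matrix (Fin n) (Fin n) ℝ) (a : Fin m)
    (x : Fin m → Fin n → ℝ) :
    Var[blockTerm A a x; ν] = Var[fun y => x a ⬝ᵥ A *ᵥ y; piGaussian (Fin n)] := by
  have hc : Continuous fun y : Fin n → ℝ => x a ⬝ᵥ A *ᵥ y := by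
    simp only [dotProduct, mulVec]
    fun_prop
  rw [← hν.block a]
  exact (variance_map hc.aemeasurable (measurable_pi_apply a).aemeasurable).symm

theorem variance_sum_blockTerm (A : Fin m → Matrix (Fin n) (Fin n) ℝ)
    (x : Fin m → Fin n → ℝ) :
    Var[(∑ a, blockTerm (A a) a) x; blockGaussian m n] =
      ∑ a, Var[fun y => x a ⬝ᵥ A a *ᵥ y; piGaussian (Fin n)] := by
  rw [blockGaussian, ← variance_sum_pi (X := fun a y => x a ⬝ᵥ A a *ᵥ y) fun a => ?_]
  · congr 1
    funext y
    simp [blockTerm_apply]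
  · have := IsGaussian.memLp_dual (piGaussian (Fin n))
      (LinearMap.toContinuousLinearMap (dotProductBilin ℝ ℝ (x a) ∘ₗ Matrix.mulVecLin (A a)))
      2 (by simp)
    exact this

/-- Changing the sign of one block. -/
def flipBlock (a : Fin m) (x : Fin m → Fin n → ℝ) : Fin m → Fin n → ℝ :=
  fun b => if b = a then -x b else x b

theorem measurePreserving_neg_piGaussian :
    MeasurePreserving (fun x : Fin n → ℝ => -x) (piGaussian (Fin n)) (piGaussian (Fin n)) := by
  have : MeasurePreserving (fun t : ℝ => -t) (gaussianReal 0 1) (gaussianReal 0 1) :=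
    ⟨by fun_prop, by simpa using gaussianReal_map_neg (μ := 0) (v := 1)⟩
  exact measurePreserving_pi _ _ fun _ => this

theorem measurePreserving_flipBlock (a : Fin m) :
    MeasurePreserving (flipBlock (n := n) a) (blockGaussian m n) (blockGaussian m n) := by
  refine measurePreserving_pi (f := fun b y => if b = a then -y else y) _ _ fun b => ?_
  by_cases h : b = a
  · simpa [h] using measurePreserving_neg_piGaussian
  · simp only [h, if_false]
    exact MeasurePreserving.id _

theorem IsStdBlockGaussian.prod_gaussMass_le_of_quadratic {ν : Measure (Fin m → Fin n → ℝ)}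
    (hν : IsStdBlockGaussian ν) (A : Fin m → Matrix (Fin n) (Fin n) ℝ) :
    ∏ a, gaussMass (fun x : Fin n → ℝ => (∑ i, (A a *ᵥ x) i ^ 2) / 2) ≤
      gaussCorr ν fun a x => (∑ i, (A a *ᵥ x) i ^ 2) / 2 := by
  have := hν.gaussian
  set b : (Fin m → Fin n → ℝ) →L[ℝ] (Fin m → Fin n → ℝ) →L[ℝ] ℝ := ∑ a, blockTerm (A a) a with hb
  have swap : ∀ {ν' : Measure (Fin m → Fin n → ℝ)} (h : IsStdBlockGaussian ν'),
      Integrable (fun x => Real.exp (-Var[b x; ν'] / 2)) (blockGaussian m n) ∧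
      gaussCorr ν' (fun a x => (∑ i, (A a *ᵥ x) i ^ 2) / 2) =
        ∫ x, Real.exp (-Var[b x; ν'] / 2) ∂blockGaussian m n := by
    intro ν' h
    have := h.gaussian
    obtain ⟨h1, h2⟩ := integral_exp_variance_swap (blockGaussian m n) ν'
      integral_strongDual_blockGaussian h.centered b
    refine ⟨h1, ?_⟩
    rw [h2]
    simp_rw [hb, variance_sum_blockTerm_flip, gaussCorr, ← Finset.sum_div, neg_div]
  obtain ⟨i1, e1⟩ := swap hν
  obtain ⟨i0, e0⟩ := swap (isStdBlockGaussian_blockGaussian (m := m) (n := n))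
  rw [← gaussCorr_blockGaussian, e0, e1]
  set D : (Fin m → Fin n → ℝ) → ℝ := fun x => Var[b x; blockGaussian m n] with hD
  have hDsum : ∀ x, D x = ∑ a, Var[blockTerm (A a) a x; ν] := fun x => by
    simp only [hD, hb, variance_sum_blockTerm, hν.variance_blockTerm]
  have hmem : ∀ (x : Fin m → Fin n → ℝ) (a : Fin m), MemLp (blockTerm (A a) a x) 2 ν :=
    fun x a => IsGaussian.memLp_dual ν _ 2 (by simp)
  set C : Fin m → Fin m → (Fin m → Fin n → ℝ) → ℝ := fun a a' x =>
    cov[blockTerm (A a) a x, blockTerm (A a') a' x; ν] with hC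
  have hvar : ∀ x, Var[b x; ν] = D x + ∑ a, ∑ a' ∈ Finset.univ.erase a, C a a' x := fun x => by
    have h1 : (b x : (Fin m → Fin n → ℝ) → ℝ) = fun y => ∑ a, blockTerm (A a) a x y := by
      funext y
      simp [hb]
    rw [h1, variance_fun_sum (hmem x), hDsum, ← Finset.sum_add_distrib]
    refine Finset.sum_congr rfl fun a _ => ?_
    rw [← Finset.add_sum_erase _ _ (Finset.mem_univ a), covariance_self (by fun_prop)]
  have hD0 : ∀ x, 0 ≤ D x := fun x => variance_nonneg _ _
  have hCD : ∀ a a' x, a ≠ a' → |C a a' x| ≤ D x := fun a a' x h => by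
    have h1 := variance_nonneg (⇑(blockTerm (A a) a x) + ⇑(blockTerm (A a') a' x)) ν
    have h2 := variance_nonneg (⇑(blockTerm (A a) a x) - ⇑(blockTerm (A a') a' x)) ν
    have h3 : ∑ c ∈ {a, a'}, Var[blockTerm (A c) c x; ν] ≤ D x := by
      rw [hDsum]
      exact Finset.sum_le_sum_of_subset_of_nonneg (Finset.subset_univ _)
        fun _ _ _ => variance_nonneg _ _
    rw [variance_add (hmem x a) (hmem x a')] at h1
    rw [variance_sub (hmem x a) (hmem x a')] at h2
    rw [Finset.sum_pair h] at h3
    rw [abs_le]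
    constructor <;> linarith [hD0 x]
  have hCm : ∀ a a', Measurable (C a a') := fun a a' => by
    have : C a a' = fun x => covarianceBilinDual ν (blockTerm (A a) a x) (blockTerm (A a') a' x) :=
      funext fun x => (covarianceBilinDual_eq_covariance IsGaussian.memLp_two_id _ _).symm
    rw [this]
    exact Continuous.measurable (by fun_prop)
  have hCi : ∀ a a', a ≠ a' → Integrable (fun x => C a a' x * Real.exp (-D x / 2))
      (blockGaussian m n) := fun a a' h => by
    refine Integrable.of_bound ((hCm a a').aestronglyMeasurable.mul i0.aestronglyMeasurable) 2
      (Filter.Eventually.of_forall fun x => ?_)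
    rw [norm_mul, Real.norm_eq_abs, Real.norm_eq_abs, Real.abs_exp]
    have h1 := Real.add_one_le_exp (D x / 2)
    calc _ ≤ D x * Real.exp (-D x / 2) := by gcongr; exact hCD a a' x h
      _ ≤ 2 * Real.exp (D x / 2) * Real.exp (-D x / 2) := by gcongr; linarith
      _ = 2 := by rw [mul_assoc, ← Real.exp_add]; ring_nf; simp
  have hC0 : ∀ a a', a ≠ a' → ∫ x, C a a' x * Real.exp (-D x / 2) ∂blockGaussian m n = 0 := by
    intro a a' h
    have hself : ∀ x, blockTerm (A a) a (flipBlock a x) = -blockTerm (A a) a x := fun x => by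
      ext y
      simp [blockTerm_apply, flipBlock]
    have hne : ∀ c x, c ≠ a → blockTerm (A c) c (flipBlock a x) = blockTerm (A c) c x :=
      fun c x hc => by
        ext y
        simp [blockTerm_apply, flipBlock, hc]
    have hDf : ∀ x, D (flipBlock a x) = D x := fun x => by
      rw [hDsum, hDsum]
      refine Finset.sum_congr rfl fun c _ => ?_
      by_cases hc : c = a
      · subst hc
        rw [hself]
        exact variance_neg
      · rw [hne c x hc]
    have hCf : ∀ x, C a a' (flipBlock a x) = -C a a' x := fun x => by
      simp only [hC]
      rw [hself, hne a' x h.symm]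
      exact covariance_neg_left
    have hint := integral_map (μ := blockGaussian m n) (φ := flipBlock a)
      (f := fun x => C a a' x * Real.exp (-D x / 2))
      (measurePreserving_flipBlock a).measurable.aemeasurable
      (by rw [(measurePreserving_flipBlock a).map_eq]; exact (hCi a a' h).aestronglyMeasurable)
    rw [(measurePreserving_flipBlock a).map_eq] at hint
    simp_rw [hCf, hDf, neg_mul] at hint
    rw [integral_neg] at hint
    linarith
  have hsum : ∀ x, ∑ a, ∑ a' ∈ Finset.univ.erase a, C a a' x * Real.exp (-D x / 2) =
      (∑ a, ∑ a' ∈ Finset.univ.erase a, C a a' x) * Real.exp (-D x / 2) := fun x => by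
    simp_rw [Finset.sum_mul]
  have hsi : ∀ a, ∀ a' ∈ Finset.univ.erase a, Integrable
      (fun x => C a a' x * Real.exp (-D x / 2)) (blockGaussian m n) :=
    fun a a' h => hCi a a' (Finset.ne_of_mem_erase h).symm
  have hsi2 : ∀ a, Integrable
      (fun x => ∑ a' ∈ Finset.univ.erase a, C a a' x * Real.exp (-D x / 2)) (blockGaussian m n) :=
    fun a => integrable_finsetSum _ (hsi a)
  have hint0 : ∫ x, ∑ a, ∑ a' ∈ Finset.univ.erase a, C a a' x * Real.exp (-D x / 2)
      ∂blockGaussian m n = 0 := by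
    rw [integral_finsetSum _ fun a _ => hsi2 a]
    refine Finset.sum_eq_zero fun a _ => ?_
    rw [integral_finsetSum _ (hsi a)]
    exact Finset.sum_eq_zero fun a' h => hC0 a a' (Finset.ne_of_mem_erase h).symm
  have hi := integrable_finsetSum Finset.univ fun a _ => hsi2 a
  calc ∫ x, Real.exp (-D x / 2) ∂blockGaussian m n
      = ∫ x, (Real.exp (-D x / 2) - 1 / 2 *
          ∑ a, ∑ a' ∈ Finset.univ.erase a, C a a' x * Real.exp (-D x / 2))
          ∂blockGaussian m n := by
        rw [integral_sub i0 (hi.const_mul _), integral_const_mul, hint0]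
        ring
    _ ≤ _ := by
        refine integral_mono (i0.sub (hi.const_mul _)) i1 fun x => ?_
        simp only [hvar]
        rw [hsum]
        set s := ∑ a, ∑ a' ∈ Finset.univ.erase a, C a a' x
        have h1 := Real.add_one_le_exp (-s / 2)
        rw [show -(D x + s) / 2 = -s / 2 + -D x / 2 by ring, Real.exp_add]
        nlinarith [Real.exp_pos (-D x / 2)]

end BlockGaussian

section EvenCorrelation

variable {n m : ℕ} {lam : ℝ}

theorem IsPotential.exists_mem_evenPotentials {V : (Fin n → ℝ) → ℝ} (hV : IsPotential lam V)
    (he : ∀ x, V (-x) = V x) :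
    ∃ f ∈ evenPotentials n lam, (f : (Fin n → ℝ) → ℝ) = fun x => V x + -V 0 :=
  ⟨⟨fun x => V x + -V 0, (hV.add_const _).continuous⟩,
    ⟨hV.add_const _, fun x => by simp [he], by simp⟩, rfl⟩

theorem gaussCorr_div_prod_add_const (ν : Measure (Fin m → Fin n → ℝ))
    (V : Fin m → (Fin n → ℝ) → ℝ) (k : Fin m → ℝ) :
    gaussCorr ν (fun a x => V a x + k a) / ∏ a, gaussMass (fun x => V a x + k a) =
      gaussCorr ν V / ∏ a, gaussMass (V a) := by
  simp_rw [gaussCorr_add_const, gaussMass_add_const, Finset.prod_mul_distrib]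
  exact mul_div_mul_left _ _ (Finset.prod_ne_zero_iff.2 fun a _ => (Real.exp_pos _).ne')

theorem IsStdBlockGaussian.prod_gaussMass_le_of_even {ν : Measure (Fin m → Fin n → ℝ)}
    (hν : IsStdBlockGaussian ν) (hlam : 0 ≤ lam) {V : Fin m → (Fin n → ℝ) → ℝ}
    (hV : ∀ a, IsPotential lam (V a)) (he : ∀ a x, V a (-x) = V a x) :
    ∏ a, gaussMass (V a) ≤ gaussCorr ν V := by
  have := hν.gaussian
  obtain ⟨f, hf, hmin, hent⟩ := exists_minimal_evenPotentials ν hlam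
  set κ := gaussCorr ν (fun a => f a) / ∏ a, gaussMass (f a) with hκ
  have hfM : 0 < ∏ a, gaussMass (f a) := Finset.prod_pos fun a _ => (hf a).1.gaussMass_pos
  have hκ0 : 0 < κ := div_pos (gaussCorr_pos (fun a => (hf a).1) ν) hfM
  have hfC : gaussCorr ν (fun a => f a) = κ * ∏ a, gaussMass (f a) := by
    rw [hκ, div_mul_cancel₀ _ hfM.ne']
  have hle : ∀ U : Fin m → (Fin n → ℝ) → ℝ, (∀ a, IsPotential lam (U a)) →
      (∀ a x, U a (-x) = U a x) → κ * ∏ a, gaussMass (U a) ≤ gaussCorr ν U := by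
    intro U hU hUe
    choose g hg hgU using fun a => (hU a).exists_mem_evenPotentials (hUe a)
    have := hmin g hg
    simp_rw [hgU] at this
    rwa [gaussCorr_div_prod_add_const, le_div_iff₀
      (Finset.prod_pos fun a _ => (hU a).gaussMass_pos)] at this
  have hT := mul_gaussCorr_rotMarginal_le (fun a => (hf a).1) ν hν.centered
    fun x => hle _ (fun a => (hf a).1.rotSection (x a)) fun a y => rotSection_neg_right _ _ _
  have hTe : ∀ a x, rotMarginal (f a) (-x) = rotMarginal (f a) x :=
    fun a x => rotMarginal_neg (hf a).2.1 x
  choose g hg hgT using fun a => (hf a).1.rotMarginal.exists_mem_evenPotentials (hTe a)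
  have hgle : gaussCorr ν (fun a => g a) / ∏ a, gaussMass (g a) ≤ κ := by
    simp_rw [hgT]
    rw [gaussCorr_div_prod_add_const, div_le_iff₀
      (Finset.prod_pos fun a _ => (hf a).1.rotMarginal.gaussMass_pos)]
    simp_rw [fun a => (hf a).1.gaussMass_rotMarginal, Finset.prod_pow]
    rw [hfC] at hT
    refine le_of_mul_le_mul_left ?_ hκ0
    linarith
  have hf0 : ∀ a x, 0 ≤ f a x := fun a => evenPotentials_nonneg (hf a)
  have hEg : ∀ a, gaussEnt (g a) = gaussEnt (rotMarginal (f a)) := fun a => by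
    rw [hgT]
    exact gaussEnt_add_const (hf a).1.rotMarginal (rotMarginal_nonneg (hf a).1 (hf0 a)) _
  have hsum := hent g hg hgle
  simp_rw [hEg] at hsum
  have hEle : ∀ a, gaussEnt (rotMarginal (f a)) ≤ gaussEnt (f a) := fun a =>
    gaussEnt_rotMarginal_le (hf a).1 (hf a).2.1 (hf0 a)
  have hEq := (Finset.sum_eq_sum_iff_of_le fun a _ => hEle a).1
    (le_antisymm (Finset.sum_le_sum fun a _ => hEle a) hsum)
  choose A hA using fun a => exists_matrix_of_parallelogram (hf a).1.continuous (hf0 a)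
    (parallelogram_of_gaussEnt_le (hf a).1 (hf a).2.1 (hf a).2.2 (hEq a (Finset.mem_univ a)).ge)
  have hA' : ∀ a, (f a : (Fin n → ℝ) → ℝ) = fun x => (∑ i, (A a *ᵥ x) i ^ 2) / 2 :=
    fun a => funext (hA a)
  have hquad := hν.prod_gaussMass_le_of_quadratic A
  simp_rw [← hA'] at hquad
  have hκ1 : 1 ≤ κ := by
    rw [hκ, one_le_div hfM]
    exact hquad.trans_eq (congrArg (gaussCorr ν) (funext hA').symm)
  refine le_trans ?_ (hle V hV he)
  exact le_mul_of_one_le_left (Finset.prod_nonneg fun a _ => (hV a).gaussMass_pos.le) hκ1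

end EvenCorrelation

section CenteredCorrelation

variable {n m : ℕ} {lam : ℝ}

theorem integral_strongDual_mul_eq_zero {h : (Fin n → ℝ) → ℝ}
    (hi : ∀ i, Integrable (fun x : Fin n → ℝ => x i * h x) (piGaussian (Fin n)))
    (h0 : ∀ i, ∫ x : Fin n → ℝ, x i * h x ∂piGaussian (Fin n) = 0)
    (L : StrongDual ℝ (Fin n → ℝ)) :
    Integrable (fun x => L x * h x) (piGaussian (Fin n)) ∧
      ∫ x, L x * h x ∂piGaussian (Fin n) = 0 := by
  have hL : ∀ x, L x * h x = ∑ i, L (Pi.single i 1) * (x i * h x) := fun x => by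
    rw [strongDual_apply_eq_sum, Finset.sum_mul]
    exact Finset.sum_congr rfl fun i _ => by ring
  simp_rw [hL]
  have hi' := fun i => (hi i).const_mul (L (Pi.single i 1))
  refine ⟨integrable_finsetSum _ fun i _ => hi' i, ?_⟩
  rw [integral_finsetSum _ fun i _ => hi' i]
  exact Finset.sum_eq_zero fun i _ => by rw [integral_const_mul, h0, mul_zero]

theorem IsPotential.apply_zero_nonpos {V : (Fin n → ℝ) → ℝ} (hV : IsPotential lam V)
    (hmass : gaussMass V = 1)
    (hcen : ∀ i, ∫ x : Fin n → ℝ, x i * Real.exp (-V x) ∂piGaussian _ = 0) : V 0 ≤ 0 := by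
  by_contra! hpos
  obtain ⟨l, c, hle, heq⟩ := ConvexOn.exists_affine_le_of_lt (𝕜 := ℝ) (Set.mem_univ 0)
    (half_lt_self hpos) isClosed_univ hV.continuous.continuousOn.lowerSemicontinuousOn hV.convex
  have hc : c = V 0 / 2 := by simpa using heq
  have hle' : ∀ x, l x + c ≤ V x := fun x => by simpa using hle ⟨x, Set.mem_univ x⟩
  have hi := hV.integrable (μ := piGaussian (Fin n))
  obtain ⟨h1, h2⟩ := integral_strongDual_mul_eq_zero
    (fun i => hV.integrable_eval_mul i) hcen l
  have hmono : ∫ x, (l x * Real.exp (-V x) + (c + 1) * Real.exp (-V x)) ∂piGaussian (Fin n) ≤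
      ∫ _, (1 : ℝ) ∂piGaussian (Fin n) := by
    refine integral_mono (h1.add (hi.const_mul _)) (integrable_const _) fun x => ?_
    have h3 := Real.add_one_le_exp (V x)
    have h4 := mul_le_mul_of_nonneg_right ((add_le_add_left (hle' x) 1).trans h3)
      (Real.exp_pos (-V x)).le
    rw [← Real.exp_add, add_neg_cancel, Real.exp_zero] at h4
    simp only
    linarith
  rw [integral_add h1 (hi.const_mul _), h2, integral_const_mul, ← gaussMass, hmass] at hmono
  simp at hmono
  linarith

theorem IsPotential.add_neg_le {V : (Fin n → ℝ) → ℝ} (hV : IsPotential lam V) (x : Fin n → ℝ) :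
    V x + V (-x) ≤ 2 * V 0 + lam * normSqPi x := by
  have := IsPotential.convex_iff.1 hV.smooth x (-x) (1 / 2) (1 / 2) (by norm_num) (by norm_num)
    (by norm_num)
  rw [normSqPi_neg, smul_neg, add_neg_cancel, normSqPi_zero] at this
  linarith

theorem IsStdBlockGaussian.map_neg {ν : Measure (Fin m → Fin n → ℝ)}
    (hν : IsStdBlockGaussian ν) : ν.map (fun x => -x) = ν := by
  have := hν.gaussian
  refine Measure.ext_of_charFunDual (funext fun L => ?_)
  have h := charFunDual_map (μ := ν) (-ContinuousLinearMap.id ℝ (Fin m → Fin n → ℝ)) L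
  refine h.trans ?_
  rw [IsGaussian.charFunDual_eq_of_forall_strongDual_eq_zero hν.centered,
    IsGaussian.charFunDual_eq_of_forall_strongDual_eq_zero hν.centered]
  have : (L.comp (-ContinuousLinearMap.id ℝ (Fin m → Fin n → ℝ)) : (Fin m → Fin n → ℝ) → ℝ) =
      fun x => -L x := by
    funext x
    simp
  rw [this, variance_fun_neg]

theorem IsStdBlockGaussian.le_gaussCorr {ν : Measure (Fin m → Fin n → ℝ)}
    (hν : IsStdBlockGaussian ν) {V : Fin m → (Fin n → ℝ) → ℝ}
    (hV : ∀ a, IsPotential lam (V a)) (h0 : ∀ a, V a 0 ≤ 0) (hlam : 0 ≤ lam) :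
    ∫ x, Real.exp (-∑ a, lam / 2 * normSqPi (x a)) ∂ν ≤ gaussCorr ν V := by
  have := hν.gaussian
  have hi := integrable_exp_neg_sum hV ν
  have hmp : MeasurePreserving (fun x : Fin m → Fin n → ℝ => -x) ν ν :=
    ⟨by fun_prop, hν.map_neg⟩
  have hi' : Integrable (fun x : Fin m → Fin n → ℝ => Real.exp (-∑ a, V a ((-x) a))) ν :=
    hmp.integrable_comp_of_integrable hi
  have heq : ∫ x : Fin m → Fin n → ℝ, Real.exp (-∑ a, V a ((-x) a)) ∂ν = gaussCorr ν V := by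
    have := integral_map (μ := ν) (φ := fun x : Fin m → Fin n → ℝ => -x)
      (f := fun x => Real.exp (-∑ a, V a (x a))) (by fun_prop)
      (by rw [hν.map_neg]; exact hi.aestronglyMeasurable)
    rw [← this, hν.map_neg, gaussCorr]
  have hq : Integrable (fun x : Fin m → Fin n → ℝ =>
      Real.exp (-∑ a, lam / 2 * normSqPi (x a))) ν := by
    refine IsPotential.integrable_exp (K := 0) ?_ fun x => ?_
    · exact Continuous.measurable (by fun_prop)
    · exact neg_nonpos.2 (Finset.sum_nonneg fun a _ =>
        mul_nonneg (by linarith) (normSqPi_nonneg _))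
  calc _ ≤ ∫ x : Fin m → Fin n → ℝ, (Real.exp (-∑ a, V a (x a)) +
        Real.exp (-∑ a, V a ((-x) a))) / 2 ∂ν := by
        refine integral_mono hq ((hi.add hi').div_const 2) fun x => ?_
        have h1 : -∑ a, lam / 2 * normSqPi (x a) ≤
            -((∑ a, V a (x a)) + ∑ a, V a ((-x) a)) / 2 := by
          rw [← Finset.sum_add_distrib, neg_div, Finset.sum_div]
          refine neg_le_neg (Finset.sum_le_sum fun a _ => ?_)
          have := (hV a).add_neg_le (x a)
          have := h0 a
          simp only [Pi.neg_apply]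
          linarith
        refine (Real.exp_le_exp.2 h1).trans ?_
        set s := ∑ a, V a (x a)
        set t := ∑ a, V a ((-x) a)
        have e1 : Real.exp (-s) = Real.exp (-(s + t) / 2) * Real.exp ((t - s) / 2) := by
          rw [← Real.exp_add]; ring_nf
        have e2 : Real.exp (-t) = Real.exp (-(s + t) / 2) * Real.exp (-((t - s) / 2)) := by
          rw [← Real.exp_add]; ring_nf
        rw [e1, e2]
        nlinarith [Real.exp_pos (-(s + t) / 2), Real.add_one_le_exp ((t - s) / 2),
          Real.add_one_le_exp (-((t - s) / 2))]
    _ = gaussCorr ν V := by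
        rw [integral_div, integral_add hi hi', heq, gaussCorr]
        ring

/-- **Gaussian correlation inequality** for centered log-concave functions. -/
theorem IsStdBlockGaussian.prod_gaussMass_le {ν : Measure (Fin m → Fin n → ℝ)}
    (hν : IsStdBlockGaussian ν) (hlam : 0 ≤ lam) {V : Fin m → (Fin n → ℝ) → ℝ}
    (hV : ∀ a, IsPotential lam (V a))
    (hcen : ∀ a i, ∫ x : Fin n → ℝ, x i * Real.exp (-V a x) ∂piGaussian _ = 0) :
    ∏ a, gaussMass (V a) ≤ gaussCorr ν V := by
  have := hν.gaussian
  set c₀ := ∫ x : Fin m → Fin n → ℝ, Real.exp (-∑ a, lam / 2 * normSqPi (x a)) ∂ν with hc₀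
  have hc₀pos : 0 < c₀ := by
    refine integral_exp_pos (IsPotential.integrable_exp (K := 0) ?_ fun x => ?_)
    · exact Continuous.measurable (by fun_prop)
    · exact neg_nonpos.2 (Finset.sum_nonneg fun a _ =>
        mul_nonneg (by linarith) (normSqPi_nonneg _))
  have pow : ∀ (k : ℕ) (U : Fin m → (Fin n → ℝ) → ℝ), (∀ a, IsPotential lam (U a)) →
      (∀ a i, ∫ x : Fin n → ℝ, x i * Real.exp (-U a x) ∂piGaussian _ = 0) →
      (∀ a, gaussMass (U a) = 1) → c₀ ≤ gaussCorr ν U ^ 2 ^ k := by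
    intro k
    induction k with
    | zero =>
      intro U hU hUc hU1
      simpa using hν.le_gaussCorr hU (fun a => (hU a).apply_zero_nonpos (hU1 a) (hUc a)) hlam
    | succ k ih =>
      intro U hU hUc hU1
      have h1 := ih (fun a => rotMarginal (U a)) (fun a => (hU a).rotMarginal)
        (fun a i => (hU a).integral_eval_mul_rotMarginal i (hUc a i))
        (fun a => by rw [(hU a).gaussMass_rotMarginal, hU1, one_pow])
      have h2 := mul_gaussCorr_rotMarginal_le (κ := 1) hU ν hν.centered fun x => by
        rw [one_mul]
        exact hν.prod_gaussMass_le_of_even hlam (fun a => (hU a).rotSection (x a))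
          fun a y => rotSection_neg_right _ _ _
      rw [one_mul] at h2
      refine h1.trans ?_
      rw [pow_succ', pow_mul]
      exact pow_le_pow_left₀ (gaussCorr_pos (fun a => (hU a).rotMarginal) ν).le h2 _
  have one_le : ∀ U : Fin m → (Fin n → ℝ) → ℝ, (∀ a, IsPotential lam (U a)) →
      (∀ a i, ∫ x : Fin n → ℝ, x i * Real.exp (-U a x) ∂piGaussian _ = 0) →
      (∀ a, gaussMass (U a) = 1) → 1 ≤ gaussCorr ν U := by
    intro U hU hUc hU1
    by_contra! hlt
    have hlim := (tendsto_pow_atTop_nhds_zero_of_lt_one (gaussCorr_pos hU ν).le hlt).comp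
      (tendsto_pow_atTop_atTop_of_one_lt (one_lt_two : 1 < 2))
    exact absurd (ge_of_tendsto' hlim fun k => pow k U hU hUc hU1) (not_le.2 hc₀pos)
  set k : Fin m → ℝ := fun a => Real.log (gaussMass (V a)) with hk
  have hexp : ∀ a, Real.exp (-k a) = (gaussMass (V a))⁻¹ := fun a => by
    rw [Real.exp_neg, hk, Real.exp_log (hV a).gaussMass_pos]
  have key := one_le (fun a x => V a x + k a) (fun a => (hV a).add_const _)
    (fun a i => by
      simp_rw [neg_add_rev, Real.exp_add, mul_left_comm _ (Real.exp (-k a)), integral_const_mul]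
      rw [hcen, mul_zero])
    (fun a => by rw [gaussMass_add_const, hexp, inv_mul_cancel₀ (hV a).gaussMass_pos.ne'])
  rw [gaussCorr_add_const] at key
  simp_rw [hexp, Finset.prod_inv_distrib] at key
  rwa [inv_mul_eq_div, one_le_div (Finset.prod_pos fun a _ => (hV a).gaussMass_pos)] at key

end CenteredCorrelation

section Coisometry

variable {ι κ : Type*} [Fintype ι] [Fintype κ] {n m : ℕ}

theorem variance_strongDual_piGaussian [DecidableEq ι] (L : StrongDual ℝ (ι → ℝ)) :
    Var[L; piGaussian ι] = ∑ i, L (Pi.single i 1) ^ 2 := by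
  have h : (L : (ι → ℝ) → ℝ) =
      ∑ i, fun x : ι → ℝ => (fun t => t * L (Pi.single i 1)) (x i) := by
    funext x
    rw [strongDual_apply_eq_sum L x, Finset.sum_apply]
  rw [congrArg (fun f => Var[f; piGaussian ι]) h, piGaussian,
    variance_sum_pi (X := fun i t => t * L (Pi.single i 1)) fun i => ?_]
  · refine Finset.sum_congr rfl fun i _ => ?_
    rw [variance_mul_const, variance_fun_id_gaussianReal]
    simp
  · exact (memLp_id_gaussianReal 2).mul_const _

theorem IsGaussian.ext_of_variance {E : Type*} [NormedAddCommGroup E] [NormedSpace ℝ E]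
    [MeasurableSpace E] [BorelSpace E] [CompleteSpace E] [SecondCountableTopology E]
    {μ ν : Measure E} [IsGaussian μ] [IsGaussian ν]
    (hμ : ∀ L : StrongDual ℝ E, μ[L] = 0) (hν : ∀ L : StrongDual ℝ E, ν[L] = 0)
    (h : ∀ L : StrongDual ℝ E, Var[L; μ] = Var[L; ν]) : μ = ν :=
  Measure.ext_of_charFunDual (funext fun L => by
    rw [IsGaussian.charFunDual_eq_of_forall_strongDual_eq_zero hμ,
      IsGaussian.charFunDual_eq_of_forall_strongDual_eq_zero hν, h])

theorem sum_sq_eq_dotProduct (v : ι → ℝ) : ∑ i, v i ^ 2 = v ⬝ᵥ v := by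
  simp [dotProduct, sq]

/-- Matrix-vector multiplication as a continuous linear map. -/
def mulVecCLM (u : Matrix ι κ ℝ) : (κ → ℝ) →L[ℝ] (ι → ℝ) :=
  LinearMap.toContinuousLinearMap u.mulVecLin

theorem mulVecCLM_apply {α : Type*} (u : Matrix α κ ℝ) (x : κ → ℝ) :
    mulVecCLM u x = u *ᵥ x := rfl

theorem integral_strongDual_map_piGaussian {E : Type*} [NormedAddCommGroup E] [NormedSpace ℝ E]
    [MeasurableSpace E] [BorelSpace E] (T : (κ → ℝ) →L[ℝ] E)
    (L : StrongDual ℝ E) : ((piGaussian κ).map T)[L] = 0 := by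
  rw [integral_map (by fun_prop) (L.continuous.stronglyMeasurable.aestronglyMeasurable)]
  exact integral_strongDual_piGaussian (L ∘L T)

theorem measurePreserving_mulVecCLM [DecidableEq ι] {u : Matrix ι κ ℝ} (hu : u * uᵀ = 1) :
    MeasurePreserving (mulVecCLM u) (piGaussian κ) (piGaussian ι) := by
  classical
  refine ⟨by fun_prop, ?_⟩
  refine IsGaussian.ext_of_variance (integral_strongDual_map_piGaussian _)
    integral_strongDual_piGaussian fun L => ?_
  rw [variance_map (by fun_prop) (by fun_prop)]
  refine (variance_strongDual_piGaussian (L ∘L mulVecCLM u)).trans ?_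
  rw [variance_strongDual_piGaussian]
  set l : ι → ℝ := fun i => L (Pi.single i 1) with hl
  have h : ∀ k, (L ∘L mulVecCLM u) (Pi.single k 1) = (l ᵥ* u) k := fun k => by
    rw [ContinuousLinearMap.comp_apply, strongDual_apply_eq_sum, mulVecCLM_apply]
    simp [vecMul, dotProduct, hl, mul_comm]
  simp_rw [h]
  change _ = ∑ i, l i ^ 2
  rw [sum_sq_eq_dotProduct, sum_sq_eq_dotProduct, ← dotProduct_mulVec, mulVec_vecMul, hu, one_mulVec]

/-- The block Gaussian vector with coefficient matrices `u a`. -/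
def blockMap (u : Fin m → Matrix (Fin n) κ ℝ) : (κ → ℝ) →L[ℝ] (Fin m → Fin n → ℝ) :=
  ContinuousLinearMap.pi fun a => mulVecCLM (u a)

theorem blockMap_apply (u : Fin m → Matrix (Fin n) κ ℝ) (x : κ → ℝ) (a : Fin m) :
    blockMap u x a = u a *ᵥ x := rfl

theorem isStdBlockGaussian_map_blockMap {u : Fin m → Matrix (Fin n) κ ℝ}
    (hu : ∀ a, u a * (u a)ᵀ = 1) : IsStdBlockGaussian ((piGaussian κ).map (blockMap u)) where
  gaussian := inferInstance
  centered := integral_strongDual_map_piGaussian _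
  block a := by
    rw [Measure.map_map (by fun_prop) (by fun_prop)]
    exact (measurePreserving_mulVecCLM (hu a)).map_eq

theorem map_blockMap_eq_blockGaussian {u : Fin m → Matrix (Fin n) κ ℝ}
    (hu : ∀ a b, u a * (u b)ᵀ = if a = b then 1 else 0) :
    (piGaussian κ).map (blockMap u) = blockGaussian m n := by
  classical
  refine IsGaussian.ext_of_variance (integral_strongDual_map_piGaussian _)
    integral_strongDual_blockGaussian fun L => ?_
  rw [variance_map (by fun_prop) (by fun_prop)]
  refine (variance_strongDual_piGaussian (L ∘L blockMap u)).trans ?_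
  set L' : ∀ a : Fin m, StrongDual ℝ (Fin n → ℝ) := fun a =>
    L ∘L ContinuousLinearMap.single ℝ (fun _ => Fin n → ℝ) a with hL'
  have hL : ∀ x, L x = ∑ a, L' a (x a) := fun x => by
    simp only [hL', ContinuousLinearMap.coe_comp, Function.comp_apply, ← map_sum]
    congr 1
    exact (Finset.univ_sum_single x).symm
  rw [show (L : (Fin m → Fin n → ℝ) → ℝ) = fun x => ∑ a, L' a (x a) from funext hL,
    variance_sum_blockGaussian]
  simp_rw [variance_strongDual_piGaussian]
  set l : Fin m → Fin n → ℝ := fun a i => L' a (Pi.single i 1) with hl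
  have h : ∀ k, (L ∘L blockMap u) (Pi.single k 1) = (∑ a, l a ᵥ* u a) k := fun k => by
    rw [ContinuousLinearMap.comp_apply, hL, Finset.sum_apply]
    refine Finset.sum_congr rfl fun a _ => ?_
    rw [strongDual_apply_eq_sum, blockMap_apply]
    simp [vecMul, dotProduct, hl, mul_comm]
  simp_rw [h]
  rw [sum_sq_eq_dotProduct, sum_dotProduct]
  refine Finset.sum_congr rfl fun a _ => ?_
  change _ = ∑ i, l a i ^ 2
  rw [sum_sq_eq_dotProduct, dotProduct_sum, Finset.sum_eq_single a]
  · rw [← dotProduct_mulVec, mulVec_vecMul, hu, if_pos rfl, one_mulVec]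
  · intro b _ hb
    rw [← dotProduct_mulVec, mulVec_vecMul, hu, if_neg (Ne.symm hb), zero_mulVec,
      dotProduct_zero]
  · simp

end Coisometry

section Deviation

variable {n m : ℕ}

/-- The deviation of the coordinate `x i` from the mean. -/
def dev (x : Fin n → ℝ) (i : Fin n) : ℝ := x i - (∑ j, x j) / n

@[fun_prop]
theorem continuous_dev (i : Fin n) : Continuous fun x : Fin n → ℝ => dev x i := by
  unfold dev
  fun_prop

theorem dev_combo (x y : Fin n → ℝ) (a b : ℝ) (i : Fin n) :
    dev (a • x + b • y) i = a * dev x i + b * dev y i := by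
  simp only [dev, Pi.add_apply, Pi.smul_apply, smul_eq_mul, Finset.sum_add_distrib,
    ← Finset.mul_sum]
  ring

theorem sum_dev (hn : n ≠ 0) (x : Fin n → ℝ) : ∑ i, dev x i = 0 := by
  have : (n : ℝ) ≠ 0 := Nat.cast_ne_zero.2 hn
  simp only [dev, Finset.sum_sub_distrib, Finset.sum_const, Finset.card_univ, Fintype.card_fin,
    nsmul_eq_mul]
  field_simp
  ring

theorem normSqPi_eq_add_dev (hn : n ≠ 0) (x : Fin n → ℝ) :
    normSqPi x = (∑ j, x j) ^ 2 / n + ∑ i, dev x i ^ 2 := by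
  have h0 : (n : ℝ) ≠ 0 := Nat.cast_ne_zero.2 hn
  have h1 : ∀ i, x i ^ 2 = dev x i ^ 2 + 2 * ((∑ j, x j) / n) * dev x i +
      ((∑ j, x j) / n) ^ 2 := fun i => by
    unfold dev; ring
  rw [normSqPi]
  simp_rw [h1]
  rw [Finset.sum_add_distrib, Finset.sum_add_distrib, ← Finset.mul_sum, sum_dev hn]
  simp only [Finset.sum_const, Finset.card_univ, Fintype.card_fin, nsmul_eq_mul]
  field_simp
  ring

theorem sq_max_zero_combo_le {a b : ℝ} (ha : 0 ≤ a) (hb : 0 ≤ b) (hab : a + b = 1) (s y z : ℝ) :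
    (max (a * y + b * z - s) 0) ^ 2 ≤ a * (max (y - s) 0) ^ 2 + b * (max (z - s) 0) ^ 2 := by
  have h : max (a * y + b * z - s) 0 ≤ a * max (y - s) 0 + b * max (z - s) 0 := by
    refine max_le ?_ (by positivity)
    have h1 := mul_le_mul_of_nonneg_left (le_max_left (y - s) 0) ha
    have h2 := mul_le_mul_of_nonneg_left (le_max_left (z - s) 0) hb
    have h3 : s = (a + b) * s := by rw [hab, one_mul]
    nlinarith
  refine (pow_le_pow_left₀ (le_max_right _ _) h 2).trans ?_
  obtain rfl : b = 1 - a := by linarith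
  nlinarith [mul_nonneg (mul_nonneg ha hb) (sq_nonneg (max (y - s) 0 - max (z - s) 0))]

/-- A smooth convex penalty for the event that some deviation exceeds `t`. -/
def devPotential (β t : ℝ) (x : Fin n → ℝ) : ℝ := β * ∑ i, (max (dev x i - t) 0) ^ 2

theorem devPotential_nonneg {β : ℝ} (hβ : 0 ≤ β) (t : ℝ) (x : Fin n → ℝ) :
    0 ≤ devPotential β t x :=
  mul_nonneg hβ (Finset.sum_nonneg fun _ _ => sq_nonneg _)

theorem isPotential_devPotential (hn : n ≠ 0) {β : ℝ} (hβ : 0 ≤ β) (t : ℝ) :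
    IsPotential (2 * β) (devPotential (n := n) β t) := by
  refine ⟨IsPotential.convex_iff.2 fun x y a b ha hb hab => ?_,
    IsPotential.convex_iff.2 fun x y a b ha hb hab => ?_, 0, devPotential_nonneg hβ t⟩
  · have h : ∑ i, (max (dev (a • x + b • y) i - t) 0) ^ 2 ≤
        a * ∑ i, (max (dev x i - t) 0) ^ 2 + b * ∑ i, (max (dev y i - t) 0) ^ 2 := by
      rw [Finset.mul_sum, Finset.mul_sum, ← Finset.sum_add_distrib]
      exact Finset.sum_le_sum fun i _ => by
        rw [dev_combo]; exact sq_max_zero_combo_le ha.le hb.le hab _ _ _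
    have := mul_le_mul_of_nonneg_left h hβ
    simp only [devPotential]
    linarith
  · have hrep : ∀ x : Fin n → ℝ, 2 * β / 2 * normSqPi x - devPotential β t x =
        β * ((∑ j, x j) ^ 2 / n + (∑ i, (max (-dev x i - -t) 0) ^ 2) - n * t ^ 2) := fun x => by
      have h1 : ∀ i, (max (-dev x i - -t) 0) ^ 2 =
          dev x i ^ 2 - (max (dev x i - t) 0) ^ 2 - 2 * t * dev x i + t ^ 2 := fun i => by
        rcases le_total (dev x i) t with h | h
        · rw [max_eq_left (by linarith), max_eq_right (by linarith)]; ring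
        · rw [max_eq_right (by linarith), max_eq_left (by linarith)]; ring
      simp_rw [h1]
      rw [normSqPi_eq_add_dev hn, devPotential, Finset.sum_add_distrib, Finset.sum_sub_distrib,
        Finset.sum_sub_distrib, ← Finset.mul_sum, sum_dev hn]
      simp only [Finset.sum_const, Finset.card_univ, Fintype.card_fin, nsmul_eq_mul]
      ring
    simp only [hrep]
    have h2 : ∑ i, (max (-dev (a • x + b • y) i - -t) 0) ^ 2 ≤
        a * ∑ i, (max (-dev x i - -t) 0) ^ 2 + b * ∑ i, (max (-dev y i - -t) 0) ^ 2 := by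
      rw [Finset.mul_sum, Finset.mul_sum, ← Finset.sum_add_distrib]
      refine Finset.sum_le_sum fun i _ => ?_
      have := sq_max_zero_combo_le ha.le hb.le hab (-t) (-dev x i) (-dev y i)
      rwa [show a * -dev x i + b * -dev y i = -dev (a • x + b • y) i by
        rw [dev_combo]; ring] at this
    have h3 : (∑ j, (a • x + b • y) j) ^ 2 / n ≤
        a * ((∑ j, x j) ^ 2 / n) + b * ((∑ j, y j) ^ 2 / n) := by
      simp only [Pi.add_apply, Pi.smul_apply, smul_eq_mul, Finset.sum_add_distrib,
        ← Finset.mul_sum, ← mul_div_assoc, ← add_div]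
      refine div_le_div_of_nonneg_right ?_ (Nat.cast_nonneg _)
      obtain rfl : b = 1 - a := by linarith
      nlinarith [mul_nonneg (mul_nonneg ha.le hb.le) (sq_nonneg (∑ j, x j - ∑ j, y j))]
    have h4 := mul_le_mul_of_nonneg_left (add_le_add h3 h2) hβ
    have h5 : β * (n * t ^ 2) = (a + b) * (β * (n * t ^ 2)) := by rw [hab, one_mul]
    linarith

/-- The reflection which flips the mean and fixes the deviations. -/
def meanReflection (n : ℕ) : Matrix (Fin n) (Fin n) ℝ :=
  1 - (2 / n : ℝ) • Matrix.of fun _ _ => 1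

theorem meanReflection_mulVec (x : Fin n → ℝ) (i : Fin n) :
    (meanReflection n *ᵥ x) i = x i - 2 / n * ∑ j, x j := by
  rw [meanReflection, sub_mulVec, one_mulVec, smul_mulVec]
  simp [mulVec, dotProduct]

theorem meanReflection_mul_transpose (hn : n ≠ 0) :
    meanReflection n * (meanReflection n)ᵀ = 1 := by
  have h0 : (n : ℝ) ≠ 0 := Nat.cast_ne_zero.2 hn
  have h1 : (Matrix.of fun _ _ => (1 : ℝ) : Matrix (Fin n) (Fin n) ℝ) *
      (Matrix.of fun _ _ => (1 : ℝ)) = (n : ℝ) • Matrix.of fun _ _ => 1 := by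
    ext i j
    simp [mul_apply]
  have h2 : (Matrix.of fun _ _ => (1 : ℝ) : Matrix (Fin n) (Fin n) ℝ)ᵀ =
      Matrix.of fun _ _ => 1 := rfl
  rw [meanReflection, transpose_sub, transpose_one, transpose_smul, h2, sub_mul, mul_sub, mul_sub,
    one_mul, mul_one, one_mul, smul_mul, Matrix.mul_smul, h1, smul_smul, smul_smul]
  have h3 : 2 / (n : ℝ) * (2 / n) * n = 2 / n + 2 / n := by field_simp; norm_num
  rw [h3, add_smul]
  abel

theorem sum_meanReflection (hn : n ≠ 0) (x : Fin n → ℝ) :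
    ∑ i, (meanReflection n *ᵥ x) i = -∑ i, x i := by
  have h0 : (n : ℝ) ≠ 0 := Nat.cast_ne_zero.2 hn
  simp only [meanReflection_mulVec, Finset.sum_sub_distrib, Finset.sum_const, Finset.card_univ,
    Fintype.card_fin, nsmul_eq_mul]
  field_simp
  ring

theorem dev_meanReflection (hn : n ≠ 0) (x : Fin n → ℝ) (i : Fin n) :
    dev (meanReflection n *ᵥ x) i = dev x i := by
  rw [dev, sum_meanReflection hn, meanReflection_mulVec, dev]
  ring

theorem dev_comp_perm (σ : Equiv.Perm (Fin n)) (x : Fin n → ℝ) (i : Fin n) :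
    dev (x ∘ σ) i = dev x (σ i) := by
  simp only [dev, Function.comp_apply, Equiv.sum_comp σ x]

theorem devPotential_comp_perm (β t : ℝ) (σ : Equiv.Perm (Fin n)) (x : Fin n → ℝ) :
    devPotential β t (x ∘ σ) = devPotential β t x := by
  simp only [devPotential, dev_comp_perm]
  rw [Equiv.sum_comp σ fun i => (max (dev x i - t) 0) ^ 2]

theorem measurePreserving_comp_perm (σ : Equiv.Perm (Fin n)) :
    MeasurePreserving (fun x : Fin n → ℝ => x ∘ σ) (piGaussian (Fin n)) (piGaussian (Fin n)) :=
  measurePreserving_arrowCongr' _ _ σ.symm (MeasurableEquiv.refl ℝ) fun _ => MeasurePreserving.id _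

theorem integral_eval_mul_devPotential (hn : n ≠ 0) {β : ℝ} (hβ : 0 ≤ β) (t : ℝ) (i : Fin n) :
    ∫ x : Fin n → ℝ, x i * Real.exp (-devPotential β t x) ∂piGaussian _ = 0 := by
  have h0 : (n : ℝ) ≠ 0 := Nat.cast_ne_zero.2 hn
  have hV := isPotential_devPotential hn hβ t
  have hint := fun i => hV.integrable_eval_mul i
  have hperm : ∀ j, ∫ x : Fin n → ℝ, x j * Real.exp (-devPotential β t x) ∂piGaussian _ =
      ∫ x : Fin n → ℝ, x i * Real.exp (-devPotential β t x) ∂piGaussian _ := fun j => by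
    have h := (measurePreserving_comp_perm (Equiv.swap i j)).integral_comp'
      (f := MeasurableEquiv.arrowCongr' (Equiv.swap i j).symm (MeasurableEquiv.refl ℝ))
      (g := fun x : Fin n → ℝ => x i * Real.exp (-devPotential β t x))
    rw [← h]
    refine integral_congr_ae (Filter.Eventually.of_forall fun x => ?_)
    change _ = (x ∘ Equiv.swap i j) i * Real.exp (-devPotential β t (x ∘ Equiv.swap i j))
    rw [devPotential_comp_perm, Function.comp_apply, Equiv.swap_apply_left]
  set F : (Fin n → ℝ) → ℝ := fun x => (∑ j, x j) * Real.exp (-devPotential β t x) with hF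
  have hsum : ∫ x, F x ∂piGaussian (Fin n) =
      n * ∫ x : Fin n → ℝ, x i * Real.exp (-devPotential β t x) ∂piGaussian _ := by
    simp only [hF, Finset.sum_mul]
    rw [integral_finsetSum _ fun j _ => hint j]
    simp [hperm]
  have hFm : Continuous F := by
    have := hV.continuous
    simp only [hF]
    fun_prop
  have hrefl : ∫ x, F x ∂piGaussian (Fin n) = -∫ x, F x ∂piGaussian (Fin n) := by
    have hmp := measurePreserving_mulVecCLM (meanReflection_mul_transpose hn)
    have h := integral_map (μ := piGaussian (Fin n)) hmp.measurable.aemeasurable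
      (hFm.aestronglyMeasurable)
    rw [hmp.map_eq] at h
    rw [← integral_neg]
    refine h.trans (integral_congr_ae (Filter.Eventually.of_forall fun x => ?_))
    simp only [hF, mulVecCLM_apply, sum_meanReflection hn, devPotential, dev_meanReflection hn]
    ring
  have hzero : (n : ℝ) * ∫ x : Fin n → ℝ, x i * Real.exp (-devPotential β t x) ∂piGaussian _ = 0 := by
    rw [← hsum]; linarith
  exact (mul_eq_zero.1 hzero).resolve_left h0

end Deviation

section MaxDeviation

variable {n m : ℕ}

/-- The set of block vectors all of whose deviations are at most `t`. -/
def devLE (m n : ℕ) (t : ℝ) : Set (Fin m → Fin n → ℝ) := {x | ∀ a i, dev (x a) i ≤ t}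

theorem measurableSet_devLE (t : ℝ) : MeasurableSet (devLE m n t) := by
  refine IsClosed.measurableSet ?_
  simp only [devLE, Set.ofPred_forall]
  exact isClosed_iInter fun a => isClosed_iInter fun i =>
    isClosed_le (by fun_prop) continuous_const

theorem tendsto_gaussCorr_devPotential (hn : n ≠ 0) (ν : Measure (Fin m → Fin n → ℝ))
    [IsProbabilityMeasure ν] (t : ℝ) :
    Filter.Tendsto (fun k : ℕ => gaussCorr ν fun _ => devPotential k t) Filter.atTop
      (nhds (ν.real (devLE m n t))) := by
  rw [← integral_indicator_one (measurableSet_devLE t)]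
  refine tendsto_integral_of_dominated_convergence (fun _ => 1)
    (fun k => (integrable_exp_neg_sum (fun _ => isPotential_devPotential hn k.cast_nonneg t)
      ν).aestronglyMeasurable) (integrable_const _)
    (fun k => Filter.Eventually.of_forall fun x => ?_) (Filter.Eventually.of_forall fun x => ?_)
  · rw [Real.norm_eq_abs, Real.abs_exp, Real.exp_le_one_iff]
    exact neg_nonpos.2 (Finset.sum_nonneg fun a _ => devPotential_nonneg k.cast_nonneg t _)
  · set c : ℝ := ∑ a, ∑ i, (max (dev (x a) i - t) 0) ^ 2 with hc
    have hk : ∀ k : ℕ, -∑ a, devPotential k t (x a) = -(k * c) := fun k => by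
      rw [hc, Finset.mul_sum]; rfl
    simp_rw [hk]
    by_cases hx : x ∈ devLE m n t
    · have hc0 : c = 0 := Finset.sum_eq_zero fun a _ => Finset.sum_eq_zero fun i _ => by
        rw [max_eq_right (by linarith [hx a i])]; norm_num
      simp [hx, hc0]
    · rw [Set.indicator_of_notMem hx]
      have hcpos : 0 < c := by
        simp only [devLE, Set.mem_ofPred_eq, not_forall, not_le] at hx
        obtain ⟨a, i, hai⟩ := hx
        refine Finset.sum_pos' (fun _ _ => Finset.sum_nonneg fun _ _ => sq_nonneg _)
          ⟨a, Finset.mem_univ _, Finset.sum_pos' (fun _ _ => sq_nonneg _)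
            ⟨i, Finset.mem_univ _, ?_⟩⟩
        rw [max_eq_left (by linarith)]
        exact pow_pos (by linarith) 2
      refine Real.tendsto_exp_atBot.comp (Filter.tendsto_neg_atTop_atBot.comp ?_)
      exact tendsto_natCast_atTop_atTop.atTop_mul_const hcpos

theorem IsStdBlockGaussian.measureReal_devLE_le {ν : Measure (Fin m → Fin n → ℝ)}
    (hν : IsStdBlockGaussian ν) (hn : n ≠ 0) (t : ℝ) :
    (blockGaussian m n).real (devLE m n t) ≤ ν.real (devLE m n t) := by
  have := hν.gaussian
  refine le_of_tendsto_of_tendsto' (tendsto_gaussCorr_devPotential hn _ t)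
    (tendsto_gaussCorr_devPotential hn ν t) fun k => ?_
  rw [gaussCorr_blockGaussian]
  exact hν.prod_gaussMass_le (by positivity)
    (fun _ => isPotential_devPotential hn k.cast_nonneg t)
    fun _ i => integral_eval_mul_devPotential hn k.cast_nonneg t i

/-- The largest deviation of a block vector. -/
def maxDev (x : Fin m → Fin n → ℝ) : ℝ := ⨆ p : Fin m × Fin n, dev (x p.1) p.2

theorem maxDev_nonneg (hn : n ≠ 0) (x : Fin m → Fin n → ℝ) : 0 ≤ maxDev x := by
  rcases isEmpty_or_nonempty (Fin m) with hm | ⟨⟨a⟩⟩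
  · exact Real.iSup_nonneg fun p => (hm.false p.1).elim
  · by_contra! h
    have hlt : ∀ i, dev (x a) i < 0 := fun i =>
      (le_ciSup (f := fun p : Fin m × Fin n => dev (x p.1) p.2)
        (Set.finite_range _).bddAbove (a, i)).trans_lt h
    have hne : (Finset.univ : Finset (Fin n)).Nonempty :=
      ⟨⟨0, Nat.pos_of_ne_zero hn⟩, Finset.mem_univ _⟩
    exact (Finset.sum_neg (fun i _ => hlt i) hne).ne (sum_dev hn (x a))

theorem measurable_maxDev : Measurable (maxDev (m := m) (n := n)) := by
  unfold maxDev
  exact Measurable.iSup fun p => Continuous.measurable (by fun_prop)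

theorem maxDev_le_iff {t : ℝ} (ht : 0 ≤ t) (x : Fin m → Fin n → ℝ) :
    maxDev x ≤ t ↔ x ∈ devLE m n t :=
  ⟨fun h a i => (le_ciSup (f := fun p : Fin m × Fin n => dev (x p.1) p.2)
      (Set.finite_range _).bddAbove (a, i)).trans h,
    fun h => Real.iSup_le (fun p => h p.1 p.2) ht⟩

theorem integrable_maxDev (hn : n ≠ 0) (ν : Measure (Fin m → Fin n → ℝ)) [IsGaussian ν] :
    Integrable maxDev ν := by
  have hdev : ∀ p : Fin m × Fin n,
      Integrable (fun x : Fin m → Fin n → ℝ => dev (x p.1) p.2) ν := fun p => by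
    have hev : ∀ a i, Integrable (fun x : Fin m → Fin n → ℝ => x a i) ν := fun a i =>
      IsGaussian.integrable_dual ν ((ContinuousLinearMap.proj i : (Fin n → ℝ) →L[ℝ] ℝ) ∘L
        (ContinuousLinearMap.proj a : (Fin m → Fin n → ℝ) →L[ℝ] (Fin n → ℝ)))
    unfold dev
    exact (hev _ _).sub ((integrable_finsetSum _ fun j _ => hev p.1 j).div_const _)
  refine (integrable_finsetSum Finset.univ fun p _ => (hdev p).abs).mono'
    measurable_maxDev.aestronglyMeasurable (Filter.Eventually.of_forall fun x => ?_)
  rw [Real.norm_eq_abs, abs_of_nonneg (maxDev_nonneg hn x)]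
  refine Real.iSup_le (fun p => ?_) (Finset.sum_nonneg fun _ _ => abs_nonneg _)
  exact (le_abs_self _).trans (Finset.single_le_sum
    (f := fun p : Fin m × Fin n => |dev (x p.1) p.2|) (fun _ _ => abs_nonneg _)
    (Finset.mem_univ p))

theorem IsStdBlockGaussian.integral_maxDev_le {ν : Measure (Fin m → Fin n → ℝ)}
    (hν : IsStdBlockGaussian ν) (hn : n ≠ 0) :
    ∫ x, maxDev x ∂ν ≤ ∫ x, maxDev x ∂blockGaussian m n := by
  have := hν.gaussian
  have h0 : ∀ ρ : Measure (Fin m → Fin n → ℝ), 0 ≤ᵐ[ρ] maxDev := fun ρ =>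
    Filter.Eventually.of_forall fun x => maxDev_nonneg hn x
  rw [integral_eq_lintegral_of_nonneg_ae (h0 _) measurable_maxDev.aestronglyMeasurable,
    integral_eq_lintegral_of_nonneg_ae (h0 _) measurable_maxDev.aestronglyMeasurable]
  refine ENNReal.toReal_mono (integrable_maxDev hn _).lintegral_lt_top.ne ?_
  rw [lintegral_eq_lintegral_meas_lt _ (h0 _) measurable_maxDev.aemeasurable,
    lintegral_eq_lintegral_meas_lt _ (h0 _) measurable_maxDev.aemeasurable]
  refine setLIntegral_mono' measurableSet_Ioi fun t ht => ?_
  have hset : {x : Fin m → Fin n → ℝ | t < maxDev x} = (devLE m n t)ᶜ := by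
    ext x
    rw [Set.mem_compl_iff, ← maxDev_le_iff (le_of_lt ht), Set.mem_ofPred_eq, not_le]
  rw [hset, prob_compl_eq_one_sub (measurableSet_devLE t),
    prob_compl_eq_one_sub (measurableSet_devLE t)]
  refine tsub_le_tsub_left ?_ 1
  rw [← ENNReal.toReal_le_toReal (measure_ne_top _ _) (measure_ne_top _ _)]
  exact hν.measureReal_devLE_le hn t

end MaxDeviation

section HilbertSchmidt

variable {d : ℕ}

theorem isHermitian_Qmat (ψ : Fin d → ℂ) : (Qmat ψ).IsHermitian := by
  unfold Qmat Matrix.IsHermitian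
  rw [conjTranspose_sub, conjTranspose_smul, conjTranspose_one, conjTranspose_vecMulVec, star_star]
  simp

theorem trace_Qmat (hd : d ≠ 0) {ψ : Fin d → ℂ} (hψ : star ψ ⬝ᵥ ψ = 1) : (Qmat ψ).trace = 0 := by
  have h0 : (d : ℂ) ≠ 0 := Nat.cast_ne_zero.2 hd
  rw [Qmat, trace_sub, trace_vecMulVec, dotProduct_comm, hψ, trace_smul, trace_one]
  simp [h0]

theorem trace_Qmat_mul_Qmat (hd : d ≠ 0) {ψ φ : Fin d → ℂ} (hψ : star ψ ⬝ᵥ ψ = 1)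
    (hφ : star φ ⬝ᵥ φ = 1) :
    (Qmat ψ * Qmat φ).trace.re = Complex.normSq (star ψ ⬝ᵥ φ) - 1 / d := by
  have h0 : (d : ℂ) ≠ 0 := Nat.cast_ne_zero.2 hd
  have h1 : (Qmat ψ * Qmat φ).trace = (Qmat ψ * vecMulVec φ (star φ)).trace := by
    conv_lhs => rw [Qmat.eq_1 φ, mul_sub, trace_sub, Matrix.mul_smul, mul_one, trace_smul,
      trace_Qmat hd hψ, smul_zero, sub_zero]
  have h2 : star φ ⬝ᵥ ψ = star (star ψ ⬝ᵥ φ) := star_dotProduct _ _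
  have h3 : (Qmat ψ * Qmat φ).trace = (Complex.normSq (star ψ ⬝ᵥ φ) : ℂ) - (d : ℂ)⁻¹ := by
    rw [h1, Qmat, sub_mul, trace_sub, smul_mul, one_mul, trace_smul, trace_vecMulVec,
      dotProduct_comm φ, hφ, vecMulVec_mul_vecMulVec, trace_vecMulVec,
      dotProduct_smul, dotProduct_comm ψ, h2, Complex.normSq_eq_conj_mul_self]
    simp [mul_comm]
  rw [h3, one_div, Complex.sub_re, Complex.ofReal_re]
  congr 1
  rw [← Complex.ofReal_natCast, ← Complex.ofReal_inv, Complex.ofReal_re]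

theorem IsONB.sum_Qmat (hd : d ≠ 0) {B : Fin d → Fin d → ℂ} (hB : IsONB B) :
    ∑ i, Qmat (B i) = 0 := by
  have h0 : (d : ℂ) ≠ 0 := Nat.cast_ne_zero.2 hd
  set U : Matrix (Fin d) (Fin d) ℂ := Matrix.of B with hU
  have h1 : U * Uᴴ = 1 := by
    ext i j
    rw [mul_apply, one_apply]
    have := hB j i
    rw [dotProduct] at this
    simpa [hU, mul_comm, eq_comm] using this
  have h2 : Uᴴ * U = 1 := mul_eq_one_comm.1 h1
  have h3 : ∑ i, vecMulVec (B i) (star (B i)) = (1 : Matrix (Fin d) (Fin d) ℂ) := by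
    ext i j
    have := congrFun (congrFun h2 j) i
    rw [mul_apply] at this
    rw [Matrix.sum_apply]
    simpa [hU, vecMulVec_apply, mul_comm, one_apply, eq_comm] using this
  simp only [Qmat, Finset.sum_sub_distrib, h3, Finset.sum_const, Finset.card_univ,
    Fintype.card_fin]
  rw [← Nat.cast_smul_eq_nsmul ℂ, smul_smul, mul_inv_cancel₀ h0, one_smul, sub_self]

/-- The Hilbert-Schmidt coordinates of the identity and of an orthonormal family of traceless
matrices. -/
def coordMatrix (E : Fin (d ^ 2 - 1) → Matrix (Fin d) (Fin d) ℂ) :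
    Matrix (Option (Fin (d ^ 2 - 1))) (Fin d × Fin d) ℂ :=
  Matrix.of fun k p => k.elim (if p.1 = p.2 then ((√d : ℝ) : ℂ)⁻¹ else 0) fun k => E k p.1 p.2

theorem coordMatrix_conjTranspose_mul (hd : d ≠ 0)
    {E : Fin (d ^ 2 - 1) → Matrix (Fin d) (Fin d) ℂ} (hE : ∀ k, (E k).IsHermitian)
    (hE0 : ∀ k, (E k).trace = 0)
    (hEE : ∀ k l, (E k * E l).trace = if k = l then (1 : ℂ) else 0) :
    (coordMatrix E)ᴴ * coordMatrix E = 1 := by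
  have hcard : Fintype.card (Option (Fin (d ^ 2 - 1))) = Fintype.card (Fin d × Fin d) := by
    have : 1 ≤ d ^ 2 := Nat.one_le_pow _ _ (Nat.pos_of_ne_zero hd)
    simp
    rw [Nat.sub_add_cancel this, sq]
  have hsq : ((√d : ℝ) : ℂ) * ((√d : ℝ) : ℂ) = d := by
    rw [← Complex.ofReal_mul, Real.mul_self_sqrt d.cast_nonneg, Complex.ofReal_natCast]
  have h0 : (d : ℂ) ≠ 0 := Nat.cast_ne_zero.2 hd
  have hherm : ∀ k i j, star (E k i j) = E k j i := fun k i j => (hE k).apply j i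
  have htr : ∀ k, ∑ i, E k i i = 0 := hE0
  refine (Matrix.mul_eq_one_comm_of_card_eq _ _ ℂ hcard.symm).2 ?_
  ext k l
  rw [mul_apply, Fintype.sum_prod_type]
  rcases k with _ | k <;> rcases l with _ | l
  · simp [coordMatrix, ← mul_inv, hsq, h0]
  · have := congrArg (starRingEnd ℂ) (htr l)
    rw [map_sum, map_zero] at this
    simp [coordMatrix, ← Finset.mul_sum]
    exact Or.inr this
  · simp [coordMatrix, apply_ite (starRingEnd ℂ), ← Finset.sum_mul, htr]
  · have := hEE k l
    simp only [trace, diag, mul_apply] at this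
    simp only [coordMatrix, conjTranspose_apply, of_apply, Option.elim, hherm, this, one_apply,
      Option.some_inj]

theorem sum_trace_mul_trace (hd : d ≠ 0)
    {E : Fin (d ^ 2 - 1) → Matrix (Fin d) (Fin d) ℂ} (hE : ∀ k, (E k).IsHermitian)
    (hE0 : ∀ k, (E k).trace = 0)
    (hEE : ∀ k l, (E k * E l).trace = if k = l then (1 : ℂ) else 0)
    {A C : Matrix (Fin d) (Fin d) ℂ} (hA : A.IsHermitian)
    (hA0 : A.trace = 0) :
    ∑ k, (E k * A).trace.re * (E k * C).trace.re = (A * C).trace.re := by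
  have hW := coordMatrix_conjTranspose_mul hd hE hE0 hEE
  set w : Matrix (Fin d) (Fin d) ℂ → Fin d × Fin d → ℂ := fun X p => X p.2 p.1 with hw
  have hnone : ∀ X, (coordMatrix E *ᵥ w X) none = ((√d : ℝ) : ℂ)⁻¹ * X.trace := fun X => by
    simp [mulVec, dotProduct, Fintype.sum_prod_type, coordMatrix, hw, trace, Finset.mul_sum]
  have hsome : ∀ X k, (coordMatrix E *ᵥ w X) (some k) = (E k * X).trace := fun X k => by
    simp [mulVec, dotProduct, Fintype.sum_prod_type, coordMatrix, hw, trace, mul_apply]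
  have hreal : ∀ {X Y : Matrix (Fin d) (Fin d) ℂ}, X.IsHermitian → Y.IsHermitian →
      star (X * Y).trace = (X * Y).trace := fun hX hY => by
    rw [← trace_conjTranspose, conjTranspose_mul, hX.eq, hY.eq, trace_mul_comm]
  have key : star (coordMatrix E *ᵥ w A) ⬝ᵥ (coordMatrix E *ᵥ w C) = (A * C).trace := by
    rw [star_mulVec, dotProduct_mulVec, vecMul_vecMul, hW, vecMul_one]
    simp only [dotProduct, Fintype.sum_prod_type, hw, trace, diag, mul_apply, Pi.star_apply]
    refine Finset.sum_congr rfl fun i _ => Finset.sum_congr rfl fun j _ => ?_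
    rw [hA.apply]
  rw [← key, dotProduct, Fintype.sum_option, hnone, Complex.add_re, Complex.re_sum]
  simp only [Pi.star_apply, hnone, hA0, hsome, hreal (hE _) hA, mul_zero, star_zero, zero_mul,
    Complex.zero_re, zero_add]
  refine Finset.sum_congr rfl fun k _ => ?_
  have : (E k * A).trace.im = 0 := Complex.conj_eq_iff_im.1 (hreal (hE k) hA)
  rw [Complex.mul_re, this, zero_mul, sub_zero]

end HilbertSchmidt

section Hamiltonian

variable {d : ℕ}

/-- Coefficients of the standard Gaussian blocks whose deviations are the energies of the bases
`S a`. -/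
def energyCoeff (E : Fin (d ^ 2 - 1) → Matrix (Fin d) (Fin d) ℂ)
    (S : Fin (d + 1) → Fin d → Fin d → ℂ) (a : Fin (d + 1)) :
    Matrix (Fin d) (Fin (d ^ 2 - 1) ⊕ Fin (d + 1)) ℝ :=
  Matrix.of fun i => Sum.elim (fun k => (E k * Qmat (S a i)).trace.re)
    fun b => if a = b then (√d)⁻¹ else 0

theorem energyCoeff_mul_transpose (hd : d ≠ 0)
    {E : Fin (d ^ 2 - 1) → Matrix (Fin d) (Fin d) ℂ} (hE : ∀ k, (E k).IsHermitian)
    (hE0 : ∀ k, (E k).trace = 0)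
    (hEE : ∀ k l, (E k * E l).trace = if k = l then (1 : ℂ) else 0)
    {S : Fin (d + 1) → Fin d → Fin d → ℂ} (hS : ∀ a, IsONB (S a)) (a b : Fin (d + 1))
    (i j : Fin d) :
    (energyCoeff E S a * (energyCoeff E S b)ᵀ) i j =
      Complex.normSq (star (S a i) ⬝ᵥ S b j) - 1 / d + if a = b then 1 / (d : ℝ) else 0 := by
  have hunit : ∀ a i, star (S a i) ⬝ᵥ S a i = 1 := fun a i => by simpa using hS a i i
  rw [mul_apply, Fintype.sum_sum_type]
  congr 1
  · rw [← trace_Qmat_mul_Qmat hd (hunit a i) (hunit b j)]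
    exact sum_trace_mul_trace hd hE hE0 hEE (isHermitian_Qmat _) (trace_Qmat hd (hunit a i))
  · simp only [energyCoeff, of_apply, transpose_apply, Sum.elim_inr]
    rw [Finset.sum_eq_single a (fun c _ hc => by rw [if_neg (Ne.symm hc), zero_mul]) (by simp)]
    rw [if_pos rfl]
    simp only [eq_comm (a := b)]
    split_ifs
    · rw [← mul_inv, Real.mul_self_sqrt d.cast_nonneg, one_div]
    · rw [mul_zero]

theorem energyCoeff_mul_transpose_self (hd : d ≠ 0)
    {E : Fin (d ^ 2 - 1) → Matrix (Fin d) (Fin d) ℂ} (hE : ∀ k, (E k).IsHermitian)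
    (hE0 : ∀ k, (E k).trace = 0)
    (hEE : ∀ k l, (E k * E l).trace = if k = l then (1 : ℂ) else 0)
    {S : Fin (d + 1) → Fin d → Fin d → ℂ} (hS : ∀ a, IsONB (S a)) (a : Fin (d + 1)) :
    energyCoeff E S a * (energyCoeff E S a)ᵀ = 1 := by
  ext i j
  rw [energyCoeff_mul_transpose hd hE hE0 hEE hS, hS a i j, one_apply, if_pos rfl, sub_add_cancel]
  split_ifs <;> simp

theorem IsCompleteMUB.energyCoeff_mul_transpose (hd : d ≠ 0)
    {E : Fin (d ^ 2 - 1) → Matrix (Fin d) (Fin d) ℂ} (hE : ∀ k, (E k).IsHermitian)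
    (hE0 : ∀ k, (E k).trace = 0)
    (hEE : ∀ k l, (E k * E l).trace = if k = l then (1 : ℂ) else 0)
    {B : Fin (d + 1) → Fin d → Fin d → ℂ} (hB : IsCompleteMUB B) (a b : Fin (d + 1)) :
    energyCoeff E B a * (energyCoeff E B b)ᵀ = if a = b then 1 else 0 := by
  split_ifs with h
  · subst h
    exact energyCoeff_mul_transpose_self hd hE hE0 hEE hB.1 a
  · ext i j
    rw [_root_.energyCoeff_mul_transpose hd hE hE0 hEE hB.1, hB.2 a b i j h, if_neg h]
    simp

theorem dev_energyCoeff_mulVec (hd : d ≠ 0) (E : Fin (d ^ 2 - 1) → Matrix (Fin d) (Fin d) ℂ)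
    {S : Fin (d + 1) → Fin d → Fin d → ℂ} (hS : ∀ a, IsONB (S a)) (a : Fin (d + 1)) (i : Fin d)
    (z : Fin (d ^ 2 - 1) ⊕ Fin (d + 1) → ℝ) :
    dev (energyCoeff E S a *ᵥ z) i =
      ∑ k, z (Sum.inl k) * (E k * Qmat (S a i)).trace.re := by
  have h0 : (d : ℝ) ≠ 0 := Nat.cast_ne_zero.2 hd
  have h1 : ∀ i, (energyCoeff E S a *ᵥ z) i =
      ∑ k, z (Sum.inl k) * (E k * Qmat (S a i)).trace.re + (√d)⁻¹ * z (Sum.inr a) := fun i => by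
    simp [mulVec, dotProduct, energyCoeff, mul_comm]
  have h2 : ∑ j, ∑ k, z (Sum.inl k) * (E k * Qmat (S a j)).trace.re = 0 := by
    rw [Finset.sum_comm]
    refine Finset.sum_eq_zero fun k _ => ?_
    rw [← Finset.mul_sum, ← Complex.re_sum, ← trace_sum, ← Matrix.mul_sum, (hS a).sum_Qmat hd]
    simp
  simp only [dev, h1, Finset.sum_add_distrib, h2, Finset.sum_const, Finset.card_univ,
    Fintype.card_fin, nsmul_eq_mul]
  field_simp
  ring

theorem trace_sum_smul_mul_re (E : Fin (d ^ 2 - 1) → Matrix (Fin d) (Fin d) ℂ)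
    (y : Fin (d ^ 2 - 1) → ℝ) (A : Matrix (Fin d) (Fin d) ℂ) :
    ((∑ k, (y k : ℂ) • E k) * A).trace.re = ∑ k, y k * (E k * A).trace.re := by
  rw [Matrix.sum_mul, trace_sum, Complex.re_sum]
  refine Finset.sum_congr rfl fun k _ => ?_
  rw [smul_mul, trace_smul, smul_eq_mul, Complex.re_ofReal_mul]

theorem measurePreserving_comp_inl (κ τ : Type*) [Fintype κ] [Fintype τ] :
    MeasurePreserving (fun (z : κ ⊕ τ → ℝ) k => z (Sum.inl k)) (piGaussian (κ ⊕ τ))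
      (piGaussian κ) := by
  classical
  have h := measurePreserving_mulVecCLM (u := fromCols (1 : Matrix κ κ ℝ) (0 : Matrix κ τ ℝ))
    (by rw [transpose_fromCols, fromCols_mul_fromRows]; simp)
  convert h using 1
  funext z
  rw [mulVecCLM_apply, fromCols_mulVec]
  simp
  rfl

/-- The largest energy of the Hamiltonian `M` among the vectors of `S`. -/
def maxEnergy (S : Fin (d + 1) → Fin d → Fin d → ℂ) (M : Matrix (Fin d) (Fin d) ℂ) : ℝ :=
  ⨆ p : Fin (d + 1) × Fin d, (M * Qmat (S p.1 p.2)).trace.re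

theorem maxEnergy_smul (S : Fin (d + 1) → Fin d → Fin d → ℂ) {r : ℝ} (hr : 0 ≤ r)
    (M : Matrix (Fin d) (Fin d) ℂ) : maxEnergy S ((r : ℂ) • M) = r * maxEnergy S M := by
  rw [maxEnergy, maxEnergy, Real.mul_iSup_of_nonneg hr]
  congr 1
  funext p
  rw [smul_mul, trace_smul, smul_eq_mul, Complex.re_ofReal_mul]

theorem measurable_matrix_apply (i j : Fin d) :
    Measurable fun M : Matrix (Fin d) (Fin d) ℂ => M i j :=
  (measurable_pi_apply j).comp (measurable_pi_apply i)

theorem measurable_matrix_neg : Measurable fun M : Matrix (Fin d) (Fin d) ℂ => -M :=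
  measurable_pi_lambda _ fun i => measurable_pi_lambda _ fun j =>
    (measurable_matrix_apply i j).neg

theorem measurable_maxEnergy (S : Fin (d + 1) → Fin d → Fin d → ℂ) :
    Measurable (maxEnergy S) := by
  unfold maxEnergy
  simp only [trace, diag, mul_apply]
  exact Measurable.iSup fun p => Complex.measurable_re.comp <|
    Finset.measurable_sum _ fun i _ => Finset.measurable_sum _ fun j _ => (measurable_matrix_apply i j).mul_const _

theorem iInf_trace_eq_neg_maxEnergy (S : Fin (d + 1) → Fin d → Fin d → ℂ)
    (M : Matrix (Fin d) (Fin d) ℂ) :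
    ⨅ p : Fin (d + 1) × Fin d, (M * Qmat (S p.1 p.2)).trace.re = -maxEnergy S (-M) := by
  rw [iInf, Real.sInf_def, maxEnergy, iSup]
  congr 2
  ext t
  simp [neg_eq_iff_eq_neg]

theorem measurable_maxEnergy_sum (S : Fin (d + 1) → Fin d → Fin d → ℂ)
    (E : Fin (d ^ 2 - 1) → Matrix (Fin d) (Fin d) ℂ) :
    Measurable fun y : Fin (d ^ 2 - 1) → ℝ => maxEnergy S (∑ k, (y k : ℂ) • E k) := by
  unfold maxEnergy
  simp only [trace_sum_smul_mul_re]
  fun_prop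

theorem integral_maxEnergy_eq (hd : d ≠ 0) {Ω : Type*} [MeasurableSpace Ω] {μ : Measure Ω}
    {S : Fin (d + 1) → Fin d → Fin d → ℂ} (hS : ∀ a, IsONB (S a))
    (E : Fin (d ^ 2 - 1) → Matrix (Fin d) (Fin d) ℂ) {g : Fin (d ^ 2 - 1) → Ω → ℝ}
    (hg : Measurable fun ω k => g k ω)
    (hgμ : μ.map (fun ω k => g k ω) = piGaussian (Fin (d ^ 2 - 1))) :
    ∫ ω, maxEnergy S (∑ k, (g k ω : ℂ) • E k) ∂μ =
      ∫ x, maxDev x ∂(piGaussian _).map (blockMap (energyCoeff E S)) := by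
  have hm := measurable_maxEnergy_sum S E
  have hinl := measurePreserving_comp_inl (Fin (d ^ 2 - 1)) (Fin (d + 1))
  have h1 := integral_map (μ := μ) hg.aemeasurable
    (hm.aestronglyMeasurable (μ := μ.map fun ω k => g k ω))
  have h2 := integral_map (μ := piGaussian _) hinl.measurable.aemeasurable
    (hm.aestronglyMeasurable (μ := (piGaussian _).map _))
  rw [hgμ] at h1
  rw [hinl.map_eq] at h2
  rw [← h1, h2, integral_map (by fun_prop) measurable_maxDev.aestronglyMeasurable]
  refine integral_congr_ae (Filter.Eventually.of_forall fun z => ?_)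
  simp only [maxEnergy, maxDev, trace_sum_smul_mul_re, blockMap_apply,
    dev_energyCoeff_mulVec hd E hS]

theorem IsStdGaussianHamiltonian.neg {Ω : Type*} [MeasurableSpace Ω] {μ : Measure Ω}
    {G : Ω → Matrix (Fin d) (Fin d) ℂ} (hG : IsStdGaussianHamiltonian μ G) :
    IsStdGaussianHamiltonian μ fun ω => -G ω := by
  obtain ⟨E, g, hE, hE0, hEE, hg, hgμ, hGE⟩ := hG
  refine ⟨fun k => -E k, g, fun k => (hE k).neg, fun k => by rw [trace_neg, hE0, neg_zero],
    fun k l => by rw [neg_mul_neg, hEE], hg, hgμ, fun ω => ?_⟩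
  simp [hGE]

theorem IsStdGaussianHamiltonian.measurable_maxEnergy {Ω : Type*} [MeasurableSpace Ω]
    {μ : Measure Ω} {G : Ω → Matrix (Fin d) (Fin d) ℂ} (hG : IsStdGaussianHamiltonian μ G)
    (S : Fin (d + 1) → Fin d → Fin d → ℂ) : Measurable fun ω => maxEnergy S (G ω) := by
  obtain ⟨E, g, -, -, -, hg, -, hGE⟩ := hG
  simp only [hGE]
  exact (measurable_maxEnergy_sum S E).comp hg

theorem IsStdGaussianHamiltonian.integral_maxEnergy_le (hd : d ≠ 0)
    {B : Fin (d + 1) → Fin d → Fin d → ℂ} (hB : IsCompleteMUB B)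
    {S : Fin (d + 1) → Fin d → Fin d → ℂ} (hS : ∀ a, IsONB (S a))
    {Ω : Type*} [MeasurableSpace Ω] {μ : Measure Ω}
    {G : Ω → Matrix (Fin d) (Fin d) ℂ} (hG : IsStdGaussianHamiltonian μ G) :
    ∫ ω, maxEnergy S (G ω) ∂μ ≤ ∫ ω, maxEnergy B (G ω) ∂μ := by
  obtain ⟨E, g, hE, hE0, hEE, hg, hgμ, hGE⟩ := hG
  simp only [hGE]
  rw [integral_maxEnergy_eq hd hS E hg hgμ, integral_maxEnergy_eq hd hB.1 E hg hgμ,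
    map_blockMap_eq_blockGaussian (hB.energyCoeff_mul_transpose hd hE hE0 hEE)]
  exact (isStdBlockGaussian_map_blockMap
    (energyCoeff_mul_transpose_self hd hE hE0 hEE hS)).integral_maxDev_le hd

theorem integral_mul_maxEnergy_le (hd : d ≠ 0)
    {B : Fin (d + 1) → Fin d → Fin d → ℂ} (hB : IsCompleteMUB B)
    {S : Fin (d + 1) → Fin d → Fin d → ℂ} (hS : ∀ a, IsONB (S a))
    {Ω : Type*} [MeasurableSpace Ω] {μ : Measure Ω}
    {G : Ω → Matrix (Fin d) (Fin d) ℂ} (hG : IsStdGaussianHamiltonian μ G)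
    {R : Ω → ℝ} (hR0 : ∀ ω, 0 ≤ R ω) (hR : Integrable R μ) (hindep : IndepFun R G μ) :
    ∫ ω, R ω * maxEnergy S (G ω) ∂μ ≤ ∫ ω, R ω * maxEnergy B (G ω) ∂μ := by
  have hfac : ∀ T, ∫ ω, R ω * maxEnergy T (G ω) ∂μ =
      (∫ ω, R ω ∂μ) * ∫ ω, maxEnergy T (G ω) ∂μ := fun T =>
    (hindep.comp measurable_id (measurable_maxEnergy T)).integral_fun_mul_eq_mul_integral
      hR.aestronglyMeasurable (hG.measurable_maxEnergy T).aestronglyMeasurable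
  rw [hfac, hfac]
  exact mul_le_mul_of_nonneg_left (hG.integral_maxEnergy_le hd hB hS) (integral_nonneg hR0)

end Hamiltonian

/-- **radial extension.** For `H = R·G` with `G` a standard isotropic
Gaussian Hamiltonian, `R ≥ 0` independent of `G` and integrable, the complete MUB
ensemble still maximizes the expected max and minimizes the expected min among labelled
unions of `d+1` orthonormal bases. -/
theorem mub_radial_extension {d : ℕ} (hd : 2 ≤ d)
    (B : Fin (d + 1) → Fin d → Fin d → ℂ) (hB : IsCompleteMUB B)
    (S : Fin (d + 1) → Fin d → Fin d → ℂ) (hS : ∀ a, IsONB (S a))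
    {Ω : Type*} [MeasurableSpace Ω] (μ : Measure Ω) [IsProbabilityMeasure μ]
    (G : Ω → Matrix (Fin d) (Fin d) ℂ) (hG : IsStdGaussianHamiltonian μ G)
    (R : Ω → ℝ) (hR0 : ∀ ω, 0 ≤ R ω) (hRint : Integrable R μ)
    (hindep : IndepFun R G μ)
    (H : Ω → Matrix (Fin d) (Fin d) ℂ) (hH : ∀ ω, H ω = (R ω : ℂ) • G ω) :
    ((∫ ω, (⨆ p : Fin (d + 1) × Fin d, ((H ω * Qmat (S p.1 p.2)).trace).re) ∂μ) ≤
        ∫ ω, (⨆ p : Fin (d + 1) × Fin d, ((H ω * Qmat (B p.1 p.2)).trace).re) ∂μ) ∧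
      (∫ ω, (⨅ p : Fin (d + 1) × Fin d, ((H ω * Qmat (B p.1 p.2)).trace).re) ∂μ) ≤
        ∫ ω, (⨅ p : Fin (d + 1) × Fin d, ((H ω * Qmat (S p.1 p.2)).trace).re) ∂μ := by
  have hd0 : d ≠ 0 := by omega
  have hmax : ∀ T ω, ⨆ p : Fin (d + 1) × Fin d, ((H ω * Qmat (T p.1 p.2)).trace).re =
      R ω * maxEnergy T (G ω) := fun T ω => by
    rw [← maxEnergy_smul T (hR0 ω), ← hH, maxEnergy]
  have hmin : ∀ T ω, ⨅ p : Fin (d + 1) × Fin d, ((H ω * Qmat (T p.1 p.2)).trace).re =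
      -(R ω * maxEnergy T (-G ω)) := fun T ω => by
    rw [← maxEnergy_smul T (hR0 ω), smul_neg, ← hH, iInf_trace_eq_neg_maxEnergy]
  simp_rw [hmax, hmin, integral_neg]
  exact ⟨integral_mul_maxEnergy_le hd0 hB hS hG hR0 hRint hindep,
    neg_le_neg (integral_mul_maxEnergy_le hd0 hB hS hG.neg hR0 hRint
      (hindep.comp measurable_id measurable_matrix_neg))⟩
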